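/- arXiv:1304.2163 — 2 statements merged into one kernel-verified Lean document; each statement's English description precedes it below -/
import Mathlib

section
/- For every m ∈ (9/25, 1/2), Bacciotti's system X_m has no periodic orbit and no heteroclinic connection. -/
open Real Filter Set

noncomputable section

/-- Bacciotti's system `X_m(x,y) = (y³ − x³, −x + m·y⁵)`. -/
def bacciotti (m : ℝ) (p : ℝ × ℝ) : ℝ × ℝ :=
  (p.2 ^ 3 - p.1 ^ 3, -p.1 + m * p.2 ^ 5)

/-- A (global) solution of Bacciotti's system. -/
def IsSolution (m : ℝ) (γ : ℝ → ℝ × ℝ) : Prop :=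
  ∀ t : ℝ, HasDerivAt γ (bacciotti m (γ t)) t

/-- A periodic orbit: a nonconstant `T`-periodic solution with `T > 0`. -/
def IsPeriodicOrbit (m : ℝ) (γ : ℝ → ℝ × ℝ) (T : ℝ) : Prop :=
  IsSolution m γ ∧ (¬ ∃ c : ℝ × ℝ, ∀ t, γ t = c) ∧ 0 < T ∧ Function.Periodic γ T

/-- The saddle point `p_m^+ = (m^{−1/4}, m^{−1/4})`. -/
def pPlus (m : ℝ) : ℝ × ℝ := (m ^ (-(1 : ℝ) / 4), m ^ (-(1 : ℝ) / 4))

/-- The saddle point `p_m^− = (−m^{−1/4}, −m^{−1/4})`. -/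
def pMinus (m : ℝ) : ℝ × ℝ := (-(m ^ (-(1 : ℝ) / 4)), -(m ^ (-(1 : ℝ) / 4)))

/-- A heteroclinic connection from `p_m^−` to `p_m^+`. -/
def IsHeteroclinic (m : ℝ) (γ : ℝ → ℝ × ℝ) : Prop :=
  IsSolution m γ ∧ Tendsto γ atBot (nhds (pMinus m)) ∧ Tendsto γ atTop (nhds (pPlus m))

/-- The divergence of Bacciotti's system: `div X_m(x,y) = −3x² + 5m·y⁴`. -/
def divBacciotti (m : ℝ) (p : ℝ × ℝ) : ℝ :=
  -3 * p.1 ^ 2 + 5 * m * p.2 ^ 4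

/-- `T` is the minimal period of `γ`. -/
def IsMinimalPeriod (γ : ℝ → ℝ × ℝ) (T : ℝ) : Prop :=
  0 < T ∧ Function.Periodic γ T ∧ ∀ T' : ℝ, 0 < T' → Function.Periodic γ T' → T ≤ T'

/-! ### A kernel-friendly positivity test for bivariate integer polynomials

A row `[c₀, c₁, …]` stands for `c₀ + c₁ v + …`, a list of rows `[r₀, r₁, …]` for
`r₀(v) + u r₁(v) + …`. Functions whose name ends in `Then` are in continuation-passing style and
evaluate every coefficient before passing it on, so that the kernel never has to evaluate nested
unevaluated arithmetic. They use recursors directly, again to speed up kernel reduction. -/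

namespace IntPoly

/-- Evaluate `n`, then call `k`. -/
def natThen (n : ℕ) (k : ℕ → Bool) : Bool :=
  Nat.rec (k 0) (fun m _ => k m.succ) n

/-- `k (m - n)`. -/
def subThen (m n : ℕ) (k : ℤ → Bool) : Bool :=
  Nat.rec (natThen (Nat.sub m n) fun r => k (Int.ofNat r))
    (fun d _ => natThen d fun d => k (Int.negSucc d)) (Nat.sub n m)

/-- `k (a + h * b)`. -/
def fmaThen (a : ℤ) (h : ℕ) (b : ℤ) (k : ℤ → Bool) : Bool :=
  Int.rec
    (fun n => Int.rec (fun m => natThen (Nat.add m (Nat.mul h n)) fun r => k (Int.ofNat r))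
      (fun m => subThen (Nat.mul h n) m.succ k) a)
    (fun n => Int.rec (fun m => subThen m (Nat.mul h n.succ) k)
      (fun m => natThen (Nat.add m (Nat.mul h n.succ)) fun r => k (Int.negSucc r)) a)
    b

/-- `k (-a)`. -/
def negThen (a : ℤ) (k : ℤ → Bool) : Bool :=
  Int.rec (fun m => subThen 0 m k) (fun m => k (Int.ofNat m.succ)) a

/-- `k (p + h * q)` for rows `p`, `q`. -/
def fmaRowThen (h : ℕ) (p : List ℤ) : List ℤ → (List ℤ → Bool) → Bool :=
  List.rec (motive := fun _ => List ℤ → (List ℤ → Bool) → Bool)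
    (fun q => List.rec (motive := fun _ => (List ℤ → Bool) → Bool) (fun k => k [])
      (fun b _ ih k => fmaThen 0 h b fun c => ih fun r => k (c :: r)) q)
    (fun a p ih q => List.rec (motive := fun _ => (List ℤ → Bool) → Bool) (fun k => k (a :: p))
      (fun b q _ k => fmaThen a h b fun c => ih q fun r => k (c :: r)) q) p

/-- `k (c + (v + h) * p)`. -/
def consRowThen (h : ℕ) (p : List ℤ) : ℤ → (List ℤ → Bool) → Bool :=
  List.rec (motive := fun _ => ℤ → (List ℤ → Bool) → Bool) (fun c k => k [c])
    (fun s _ ih c k => fmaThen c h s fun d => ih s fun r => k (d :: r)) p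

/-- `k (p (v + h))`. -/
def shiftRowThen (h : ℕ) (p : List ℤ) : (List ℤ → Bool) → Bool :=
  List.rec (motive := fun _ => (List ℤ → Bool) → Bool) (fun k => k [])
    (fun c _ ih k => ih fun r => consRowThen h r c k) p

/-- `k (c + (u + h) * P)`. -/
def consThen (h : ℕ) (P : List (List ℤ)) : List ℤ → (List (List ℤ) → Bool) → Bool :=
  List.rec (motive := fun _ => List ℤ → (List (List ℤ) → Bool) → Bool) (fun c k => k [c])
    (fun s _ ih c k => fmaRowThen h c s fun d => ih s fun r => k (d :: r)) P

/-- `k (P (u + g, v + h))`. -/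
def shiftThen (g h : ℕ) (P : List (List ℤ)) : (List (List ℤ) → Bool) → Bool :=
  List.rec (motive := fun _ => (List (List ℤ) → Bool) → Bool) (fun k => k [])
    (fun c _ ih k => shiftRowThen h c fun d => ih fun r => consThen g r d k) P

/-- `k (-p)`. -/
def negRowThen (p : List ℤ) : (List ℤ → Bool) → Bool :=
  List.rec (motive := fun _ => (List ℤ → Bool) → Bool) (fun k => k [])
    (fun c _ ih k => negThen c fun d => ih fun r => k (d :: r)) p

/-- `k (p (-v))`, or `k (-p (-v))` if `s` is true. -/
def flipRowThen (p : List ℤ) : Bool → (List ℤ → Bool) → Bool :=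
  List.rec (motive := fun _ => Bool → (List ℤ → Bool) → Bool) (fun _ k => k [])
    (fun c _ ih s k => Bool.rec (ih true fun r => k (c :: r))
      (negThen c fun d => ih false fun r => k (d :: r)) s) p

/-- `k (P (u, -v))`. -/
def flipVThen (P : List (List ℤ)) : (List (List ℤ) → Bool) → Bool :=
  List.rec (motive := fun _ => (List (List ℤ) → Bool) → Bool) (fun k => k [])
    (fun c _ ih k => flipRowThen c false fun d => ih fun r => k (d :: r)) P

/-- `k (P (-u, v))`, or `k (-P (-u, v))` if `s` is true. -/
def flipUThen (P : List (List ℤ)) : Bool → (List (List ℤ) → Bool) → Bool :=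
  List.rec (motive := fun _ => Bool → (List (List ℤ) → Bool) → Bool) (fun _ k => k [])
    (fun c _ ih s k => Bool.rec (ih true fun r => k (c :: r))
      (negRowThen c fun d => ih false fun r => k (d :: r)) s) P

/-- Pass on a lower bound of `p` on `[0, w]`. -/
def lowRowThen (w : ℕ) (p : List ℤ) : (ℤ → Bool) → Bool :=
  List.rec (motive := fun _ => (ℤ → Bool) → Bool) (fun k => k (Int.ofNat 0))
    (fun c _ ih k => ih fun r =>
      Int.rec (fun _ => k c) (fun m => fmaThen c w (Int.negSucc m) k) r) p

/-- Pass on a lower bound of `P` on `[0, w] × [0, z]`. -/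
def lowThen (w z : ℕ) (P : List (List ℤ)) : (ℤ → Bool) → Bool :=
  List.rec (motive := fun _ => (ℤ → Bool) → Bool) (fun k => k (Int.ofNat 0))
    (fun c _ ih k => ih fun r => lowRowThen z c fun d =>
      Int.rec (fun _ => k d) (fun m => fmaThen d w (Int.negSucc m) k) r) P

/-- An upper bound of `|p|` on `[-w, w]`. -/
def magRow (w : ℕ) (p : List ℤ) : ℕ :=
  List.rec 0 (fun c _ ih => Nat.add c.natAbs (Nat.mul w ih)) p

/-- An upper bound of `|P|` on `[-w, w] × [-z, z]`. -/
def mag (w z : ℕ) (P : List (List ℤ)) : ℕ :=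
  List.rec 0 (fun c _ ih => Nat.add (magRow z c) (Nat.mul w ih)) P

/-- The positive part of the constant coefficient. -/
def constPart (P : List (List ℤ)) : ℕ :=
  List.rec 0 (fun c _ _ => List.rec 0 (fun a _ _ => a.toNat) c) P

/-- A subdivision test (of depth at most `n`) for the nonnegativity of `P` on
`[0, w] × [0, z]`. -/
def check (n : ℕ) : ℕ → ℕ → List (List ℤ) → Bool :=
  Nat.rec (motive := fun _ => ℕ → ℕ → List (List ℤ) → Bool) (fun _ _ _ => false)
    (fun _ ih w z P => lowThen w z P fun r => Int.rec (fun _ => true)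
      (fun _ => natThen (Nat.div w 2) fun g => natThen (Nat.div z 2) fun h =>
        natThen (Nat.sub w g) fun g' => natThen (Nat.sub z h) fun h' =>
        shiftThen g h P fun Q =>
          Bool.rec (Bool.rec false (Bool.rec false (Bool.rec false
            (flipVThen Q (ih g' h)) (flipUThen Q false (ih g h'))) (ih g' h' Q)) (ih g h P)) true
            (Nat.ble (mag g' h' Q) (Nat.mul 2 (constPart Q)))) r) n

/-- Sum of rows. -/
def addRow : List ℤ → List ℤ → List ℤ
  | [], q => q
  | p, [] => p
  | a :: p, b :: q => (a + b) :: addRow p q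

/-- Sum of polynomials. -/
def add : List (List ℤ) → List (List ℤ) → List (List ℤ)
  | [], q => q
  | p, [] => p
  | a :: p, b :: q => addRow a b :: add p q

/-- The polynomial with the given terms `(c, i, j)`, each standing for `c * u ^ i * v ^ j`. -/
def ofTerms : List (ℤ × ℕ × ℕ) → List (List ℤ)
  | [] => []
  | t :: L => add (List.replicate t.2.1 [] ++ [List.replicate t.2.2 0 ++ [t.1]]) (ofTerms L)

/-- A test for the nonnegativity of `P` on `[0, w] × [0, w]`, anchored at the corner `(w, w)`. -/
def checkSquare (n w : ℕ) (P : List (List ℤ)) : Bool :=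
  shiftThen w w P fun Q => flipVThen Q fun Q => flipUThen Q false (check n w w)

theorem natThen_eq (n : ℕ) (k : ℕ → Bool) : natThen n k = k n := by
  cases n <;> rfl

theorem subThen_eq (m n : ℕ) (k : ℤ → Bool) : subThen m n k = k (m - n) := by
  have h (d : ℕ) : n - m = d → Nat.rec (motive := fun _ => Bool)
      (natThen (Nat.sub m n) fun r => k (Int.ofNat r))
      (fun d _ => natThen d fun d => k (Int.negSucc d)) d = k (m - n) := by
    intro hd
    cases d with
    | zero =>
      change natThen (m - n) (fun r => k (Int.ofNat r)) = _
      rw [natThen_eq]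
      congr 1
      rw [Int.ofNat_eq_natCast]
      omega
    | succ d =>
      change natThen d (fun d => k (Int.negSucc d)) = _
      rw [natThen_eq]
      congr 1
      omega
  exact h _ rfl

theorem fmaThen_eq (a : ℤ) (h : ℕ) (b : ℤ) (k : ℤ → Bool) : fmaThen a h b k = k (a + h * b) := by
  cases b with
  | ofNat n =>
    cases a with
    | ofNat m =>
      change natThen (m + h * n) (fun r => k (Int.ofNat r)) = _
      rw [natThen_eq]
      congr 1
    | negSucc m =>
      change subThen (h * n) (m + 1) k = _
      rw [subThen_eq]
      congr 1
  | negSucc n =>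
    cases a with
    | ofNat m =>
      change subThen m (h * (n + 1)) k = _
      rw [subThen_eq]
      congr 1
    | negSucc m =>
      change natThen (m + h * (n + 1)) (fun r => k (Int.negSucc r)) = _
      rw [natThen_eq]
      congr 1
      push_cast [Int.negSucc_eq]
      ring

theorem negThen_eq (a : ℤ) (k : ℤ → Bool) : negThen a k = k (-a) := by
  cases a with
  | ofNat m =>
    change subThen 0 m k = _
    rw [subThen_eq]
    congr 1
    simp
  | negSucc m => rfl

/-- The value of a row. -/
def evRow : List ℤ → ℝ → ℝ
  | [], _ => 0
  | c :: p, v => c + v * evRow p v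

/-- The value of a bivariate polynomial. -/
def ev : List (List ℤ) → ℝ → ℝ → ℝ
  | [], _, _ => 0
  | p :: P, u, v => evRow p v + u * ev P u v

theorem fmaRowThen_spec (h : ℕ) (p q : List ℤ) :
    ∃ r, (∀ v, evRow r v = evRow p v + h * evRow q v) ∧ ∀ k, fmaRowThen h p q k = k r := by
  induction p generalizing q with
  | nil =>
    induction q with
    | nil => exact ⟨[], fun v => by simp [evRow], fun k => rfl⟩
    | cons b q ih =>
      obtain ⟨r, hr, hk⟩ := ih
      refine ⟨(0 + h * b) :: r, fun v => ?_, fun k => ?_⟩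
      · have := hr v
        simp only [evRow] at this ⊢
        rw [this]
        push_cast
        ring
      · change fmaThen 0 h b (fun c => fmaRowThen h [] q fun r => k (c :: r)) = _
        rw [fmaThen_eq, hk]
  | cons a p ih =>
    cases q with
    | nil => exact ⟨a :: p, fun v => by simp [evRow], fun k => rfl⟩
    | cons b q =>
      obtain ⟨r, hr, hk⟩ := ih q
      refine ⟨(a + h * b) :: r, fun v => ?_, fun k => ?_⟩
      · simp only [evRow, hr]
        push_cast
        ring
      · change fmaThen a h b (fun c => fmaRowThen h p q fun r => k (c :: r)) = _
        rw [fmaThen_eq, hk]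

theorem consRowThen_spec (h : ℕ) (p : List ℤ) (c : ℤ) :
    ∃ r, (∀ v, evRow r v = c + (v + h) * evRow p v) ∧ ∀ k, consRowThen h p c k = k r := by
  induction p generalizing c with
  | nil => exact ⟨[c], fun v => by simp [evRow], fun k => rfl⟩
  | cons s p ih =>
    obtain ⟨r, hr, hk⟩ := ih s
    refine ⟨(c + h * s) :: r, fun v => ?_, fun k => ?_⟩
    · simp only [evRow, hr]
      push_cast
      ring
    · change fmaThen c h s (fun d => consRowThen h p s fun r => k (d :: r)) = _
      rw [fmaThen_eq, hk]

theorem shiftRowThen_spec (h : ℕ) (p : List ℤ) :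
    ∃ r, (∀ v, evRow r v = evRow p (v + h)) ∧ ∀ k, shiftRowThen h p k = k r := by
  induction p with
  | nil => exact ⟨[], fun v => rfl, fun k => rfl⟩
  | cons c p ih =>
    obtain ⟨r, hr, hk⟩ := ih
    obtain ⟨s, hs, hk'⟩ := consRowThen_spec h r c
    refine ⟨s, fun v => ?_, fun k => ?_⟩
    · rw [hs, hr, evRow]
    · change shiftRowThen h p (fun r => consRowThen h r c k) = _
      rw [hk, hk']

theorem consThen_spec (h : ℕ) (P : List (List ℤ)) (c : List ℤ) :
    ∃ R, (∀ u v, ev R u v = evRow c v + (u + h) * ev P u v) ∧ ∀ k, consThen h P c k = k R := by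
  induction P generalizing c with
  | nil => exact ⟨[c], fun u v => by simp [ev], fun k => rfl⟩
  | cons s P ih =>
    obtain ⟨R, hR, hk⟩ := ih s
    obtain ⟨d, hd, hk'⟩ := fmaRowThen_spec h c s
    refine ⟨d :: R, fun u v => ?_, fun k => ?_⟩
    · simp only [ev, hR, hd]
      ring
    · change fmaRowThen h c s (fun d => consThen h P s fun r => k (d :: r)) = _
      rw [hk', hk]

theorem shiftThen_spec (g h : ℕ) (P : List (List ℤ)) :
    ∃ R, (∀ u v, ev R u v = ev P (u + g) (v + h)) ∧ ∀ k, shiftThen g h P k = k R := by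
  induction P with
  | nil => exact ⟨[], fun u v => rfl, fun k => rfl⟩
  | cons c P ih =>
    obtain ⟨R, hR, hk⟩ := ih
    obtain ⟨d, hd, hk'⟩ := shiftRowThen_spec h c
    obtain ⟨S, hS, hk''⟩ := consThen_spec g R d
    refine ⟨S, fun u v => ?_, fun k => ?_⟩
    · rw [hS, hd, hR, ev]
    · change shiftRowThen h c (fun d => shiftThen g h P fun r => consThen g r d k) = _
      rw [hk', hk, hk'']

theorem negRowThen_spec (p : List ℤ) :
    ∃ r, (∀ v, evRow r v = -evRow p v) ∧ ∀ k, negRowThen p k = k r := by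
  induction p with
  | nil => exact ⟨[], fun v => by simp [evRow], fun k => rfl⟩
  | cons c p ih =>
    obtain ⟨r, hr, hk⟩ := ih
    refine ⟨-c :: r, fun v => ?_, fun k => ?_⟩
    · simp only [evRow, hr]
      push_cast
      ring
    · change negThen c (fun d => negRowThen p fun r => k (d :: r)) = _
      rw [negThen_eq, hk]

theorem flipRowThen_spec (p : List ℤ) (s : Bool) :
    ∃ r, (∀ v, evRow r v = (bif s then -1 else 1) * evRow p (-v)) ∧
      ∀ k, flipRowThen p s k = k r := by
  induction p generalizing s with
  | nil => exact ⟨[], fun v => by simp [evRow], fun k => rfl⟩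
  | cons c p ih =>
    cases s with
    | false =>
      obtain ⟨r, hr, hk⟩ := ih true
      refine ⟨c :: r, fun v => ?_, fun k => ?_⟩
      · simp only [evRow, hr, cond_true, cond_false]
        ring
      · change flipRowThen p true (fun r => k (c :: r)) = _
        rw [hk]
    | true =>
      obtain ⟨r, hr, hk⟩ := ih false
      refine ⟨-c :: r, fun v => ?_, fun k => ?_⟩
      · simp only [evRow, hr, cond_true, cond_false]
        push_cast
        ring
      · change negThen c (fun d => flipRowThen p false fun r => k (d :: r)) = _
        rw [negThen_eq, hk]

theorem flipVThen_spec (P : List (List ℤ)) :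
    ∃ R, (∀ u v, ev R u v = ev P u (-v)) ∧ ∀ k, flipVThen P k = k R := by
  induction P with
  | nil => exact ⟨[], fun u v => rfl, fun k => rfl⟩
  | cons c P ih =>
    obtain ⟨R, hR, hk⟩ := ih
    obtain ⟨d, hd, hk'⟩ := flipRowThen_spec c false
    refine ⟨d :: R, fun u v => ?_, fun k => ?_⟩
    · simp only [ev, hR, hd, cond_false]
      ring
    · change flipRowThen c false (fun d => flipVThen P fun r => k (d :: r)) = _
      rw [hk', hk]

theorem flipUThen_spec (P : List (List ℤ)) (s : Bool) :
    ∃ R, (∀ u v, ev R u v = (bif s then -1 else 1) * ev P (-u) v) ∧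
      ∀ k, flipUThen P s k = k R := by
  induction P generalizing s with
  | nil => exact ⟨[], fun u v => by simp [ev], fun k => rfl⟩
  | cons c P ih =>
    cases s with
    | false =>
      obtain ⟨R, hR, hk⟩ := ih true
      refine ⟨c :: R, fun u v => ?_, fun k => ?_⟩
      · simp only [ev, hR, cond_true, cond_false]
        ring
      · change flipUThen P true (fun r => k (c :: r)) = _
        rw [hk]
    | true =>
      obtain ⟨R, hR, hk⟩ := ih false
      obtain ⟨d, hd, hk'⟩ := negRowThen_spec c
      refine ⟨d :: R, fun u v => ?_, fun k => ?_⟩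
      · simp only [ev, hR, hd, cond_true, cond_false]
        ring
      · change negRowThen c (fun d => flipUThen P false fun r => k (d :: r)) = _
        rw [hk', hk]

theorem add_mul_ge_of_nonneg {c r x w y : ℝ} (hr : r ≤ y) (hx : 0 ≤ x) (hxw : x ≤ w) :
    c + w * min r 0 ≤ c + x * y := by
  rcases le_total r 0 with h | h
  · rw [min_eq_left h]
    nlinarith
  · rw [min_eq_right h]
    nlinarith

theorem lowRowThen_spec (w : ℕ) (p : List ℤ) :
    ∃ r : ℤ, (∀ v : ℝ, 0 ≤ v → v ≤ w → r ≤ evRow p v) ∧ ∀ k, lowRowThen w p k = k r := by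
  induction p with
  | nil => exact ⟨0, fun v _ _ => by simp [evRow], fun k => rfl⟩
  | cons c p ih =>
    obtain ⟨r, hr, hk⟩ := ih
    refine ⟨c + w * min r 0, fun v h0 hw => ?_, fun k => ?_⟩
    · push_cast
      exact add_mul_ge_of_nonneg (hr v h0 hw) h0 hw
    · change lowRowThen w p (fun r => Int.rec (fun _ => k c)
        (fun m => fmaThen c w (Int.negSucc m) k) r) = _
      rw [hk]
      cases r with
      | ofNat n => simp
      | negSucc n =>
        change fmaThen c w (Int.negSucc n) k = _
        rw [fmaThen_eq, min_eq_left (Int.negSucc_lt_zero n).le]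

theorem lowThen_spec (w z : ℕ) (P : List (List ℤ)) :
    ∃ r : ℤ, (∀ u v : ℝ, 0 ≤ u → u ≤ w → 0 ≤ v → v ≤ z → r ≤ ev P u v) ∧
      ∀ k, lowThen w z P k = k r := by
  induction P with
  | nil => exact ⟨0, fun u v _ _ _ _ => by simp [ev], fun k => rfl⟩
  | cons c P ih =>
    obtain ⟨r, hr, hk⟩ := ih
    obtain ⟨d, hd, hk'⟩ := lowRowThen_spec z c
    refine ⟨d + w * min r 0, fun u v h0 hw h0' hz => ?_, fun k => ?_⟩
    · push_cast
      exact (add_mul_ge_of_nonneg (hr u v h0 hw h0' hz) h0 hw).trans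
        (add_le_add_left (hd v h0' hz) _)
    · change lowThen w z P (fun r => lowRowThen z c fun d => Int.rec (fun _ => k d)
        (fun m => fmaThen d w (Int.negSucc m) k) r) = _
      rw [hk, hk']
      cases r with
      | ofNat n => simp
      | negSucc n =>
        change fmaThen d w (Int.negSucc n) k = _
        rw [fmaThen_eq, min_eq_left (Int.negSucc_lt_zero n).le]

theorem magRow_cons (w : ℕ) (c : ℤ) (p : List ℤ) :
    magRow w (c :: p) = c.natAbs + w * magRow w p := rfl

theorem mag_cons (w z : ℕ) (c : List ℤ) (P : List (List ℤ)) :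
    mag w z (c :: P) = magRow z c + w * mag w z P := rfl

theorem abs_evRow_le (w : ℕ) (p : List ℤ) {v : ℝ} (hv : |v| ≤ w) :
    |evRow p v| ≤ magRow w p := by
  induction p with
  | nil => simp [evRow, magRow]
  | cons c p ih =>
    rw [evRow, magRow_cons]
    push_cast
    rw [Nat.cast_natAbs, Int.cast_abs]
    refine (abs_add_le _ _).trans ?_
    rw [abs_mul]
    gcongr

theorem abs_ev_le (w z : ℕ) (P : List (List ℤ)) {u v : ℝ} (hu : |u| ≤ w) (hv : |v| ≤ z) :
    |ev P u v| ≤ mag w z P := by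
  induction P with
  | nil => simp [ev, mag]
  | cons c P ih =>
    rw [ev, mag_cons]
    push_cast
    refine (abs_add_le _ _).trans ?_
    rw [abs_mul]
    gcongr
    exact abs_evRow_le z c hv

theorem ev_nonneg_of_mag_le {w z : ℕ} {P : List (List ℤ)} (h : mag w z P ≤ 2 * constPart P)
    {u v : ℝ} (hu : |u| ≤ w) (hv : |v| ≤ z) : 0 ≤ ev P u v := by
  rcases P with _ | ⟨_ | ⟨a, p⟩, P⟩
  · simp [ev]
  · have h' := abs_ev_le w z ([] :: P) hu hv
    have : mag w z ([] :: P) = 0 := Nat.le_zero.mp h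
    rw [this, Nat.cast_zero] at h'
    exact (abs_nonpos_iff.mp h').ge
  · have h₁ := abs_evRow_le z p hv
    have h₂ := abs_ev_le w z P hu hv
    have h₃ : (a.natAbs + z * magRow z p + w * mag w z P : ℕ) ≤ 2 * a.toNat := h
    have h₄ : (z * magRow z p + w * mag w z P : ℤ) ≤ a := by
      have : ((a.natAbs + (z * magRow z p + w * mag w z P) : ℕ) : ℤ) ≤ (2 * a.toNat : ℕ) := by
        rw [← add_assoc]
        exact_mod_cast h₃
      rcases le_total 0 a with h0 | h0
      · push_cast [Int.toNat_of_nonneg h0, abs_of_nonneg h0] at this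
        linarith
      · have ha : a.toNat = 0 := Int.toNat_eq_zero.mpr h0
        push_cast [ha, abs_of_nonpos h0] at this
        have h6 : (0 : ℤ) ≤ z * magRow z p + w * mag w z P := by positivity
        linarith
    have h₅ : (z * magRow z p + w * mag w z P : ℝ) ≤ a := by exact_mod_cast h₄
    have h₆ : |v * evRow p v| ≤ z * magRow z p := by
      rw [abs_mul]
      gcongr
    have h₇ : |u * ev P u v| ≤ w * mag w z P := by
      rw [abs_mul]
      gcongr
    simp only [ev, evRow]
    linarith [neg_abs_le (v * evRow p v), neg_abs_le (u * ev P u v)]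

theorem check_succ (n w z : ℕ) (P : List (List ℤ)) : check (n + 1) w z P =
    lowThen w z P fun r => Int.rec (fun _ => true)
      (fun _ => natThen (w / 2) fun g => natThen (z / 2) fun h =>
        natThen (w - g) fun g' => natThen (z - h) fun h' =>
        shiftThen g h P fun Q =>
          Bool.rec (Bool.rec false (Bool.rec false (Bool.rec false
            (flipVThen Q (check n g' h)) (flipUThen Q false (check n g h'))) (check n g' h' Q))
            (check n g h P)) true (Nat.ble (mag g' h' Q) (2 * constPart Q))) r := rfl

theorem ev_nonneg_of_check {n w z : ℕ} {P : List (List ℤ)} (hc : check n w z P = true) {u v : ℝ}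
    (hu : 0 ≤ u) (huw : u ≤ w) (hv : 0 ≤ v) (hvz : v ≤ z) : 0 ≤ ev P u v := by
  induction n generalizing w z P u v with
  | zero => exact absurd hc Bool.false_ne_true
  | succ n ih =>
    obtain ⟨r, hr, hk⟩ := lowThen_spec w z P
    obtain ⟨Q, hQ, hkQ⟩ := shiftThen_spec (w / 2) (z / 2) P
    obtain ⟨R, hR, hkR⟩ := flipVThen_spec Q
    obtain ⟨S, hS, hkS⟩ := flipUThen_spec Q false
    rw [check_succ, hk] at hc
    cases r with
    | ofNat r => exact le_trans (by simp) (hr u v hu huw hv hvz)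
    | negSucc r =>
      simp only [natThen_eq, hkQ, hkR, hkS, cond_false, one_mul] at hc hS
      have hQ' (u v : ℝ) : ev P u v = ev Q (u - (w / 2 : ℕ)) (v - (z / 2 : ℕ)) := by
        rw [hQ]
        congr 1 <;> ring
      have hw2 : w / 2 ≤ w := Nat.div_le_self _ _
      have hz2 : z / 2 ≤ z := Nat.div_le_self _ _
      have hwc : ((w - w / 2 : ℕ) : ℝ) = w - (w / 2 : ℕ) := by push_cast [hw2]; ring
      have hzc : ((z - z / 2 : ℕ) : ℝ) = z - (z / 2 : ℕ) := by push_cast [hz2]; ring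
      have hwl : ((w / 2 : ℕ) : ℝ) ≤ (w - w / 2 : ℕ) := by
        exact_mod_cast (by omega : w / 2 ≤ w - w / 2)
      have hzl : ((z / 2 : ℕ) : ℝ) ≤ (z - z / 2 : ℕ) := by
        exact_mod_cast (by omega : z / 2 ≤ z - z / 2)
      cases hm : Nat.ble (mag (w - w / 2) (z - z / 2) Q) (2 * constPart Q) with
      | true =>
        rw [hQ']
        refine ev_nonneg_of_mag_le (Nat.le_of_ble_eq_true hm) ?_ ?_ <;> rw [abs_le] <;>
          constructor <;> linarith
      | false =>
        rw [hm] at hc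
        cases h1 : check n (w / 2) (z / 2) P with
        | false => rw [h1] at hc; exact absurd hc Bool.false_ne_true
        | true =>
          rw [h1] at hc
          cases h2 : check n (w - w / 2) (z - z / 2) Q with
          | false => rw [h2] at hc; exact absurd hc Bool.false_ne_true
          | true =>
            rw [h2] at hc
            cases h3 : check n (w / 2) (z - z / 2) S with
            | false => rw [h3] at hc; exact absurd hc Bool.false_ne_true
            | true =>
              rw [h3] at hc
              have h4 : check n (w - w / 2) (z / 2) R = true := hc
              rcases le_total u (w / 2 : ℕ) with hu' | hu' <;>
                rcases le_total v (z / 2 : ℕ) with hv' | hv'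
              · exact ih h1 hu hu' hv hv'
              · rw [hQ', ← neg_sub, ← hS]
                exact ih h3 (by linarith) (by linarith) (by linarith) (by linarith)
              · rw [hQ', ← neg_sub _ v, ← hR]
                exact ih h4 (by linarith) (by linarith) (by linarith) (by linarith)
              · rw [hQ']
                exact ih h2 (by linarith) (by linarith) (by linarith) (by linarith)

theorem evRow_addRow (p q : List ℤ) (v : ℝ) : evRow (addRow p q) v = evRow p v + evRow q v := by
  induction p generalizing q with
  | nil => simp [addRow, evRow]
  | cons a p ih =>
    cases q with
    | nil => simp [addRow, evRow]
    | cons b q =>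
      simp only [addRow, evRow, ih]
      push_cast
      ring

theorem ev_add (P Q : List (List ℤ)) (u v : ℝ) : ev (add P Q) u v = ev P u v + ev Q u v := by
  induction P generalizing Q with
  | nil => simp [add, ev]
  | cons a P ih =>
    cases Q with
    | nil => simp [add, ev]
    | cons b Q =>
      simp only [add, ev, ih, evRow_addRow]
      ring

theorem evRow_replicate (j : ℕ) (c : ℤ) (v : ℝ) :
    evRow (List.replicate j 0 ++ [c]) v = c * v ^ j := by
  induction j with
  | zero => simp [evRow]
  | succ j ih =>
    simp only [List.replicate_succ, List.cons_append, evRow, ih]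
    push_cast
    ring

theorem ev_replicate (i : ℕ) (p : List ℤ) (u v : ℝ) :
    ev (List.replicate i [] ++ [p]) u v = u ^ i * evRow p v := by
  induction i with
  | zero => simp [ev]
  | succ i ih =>
    simp only [List.replicate_succ, List.cons_append, ev, ih, evRow]
    ring

/-- The value of the polynomial with the given terms `(c, i, j)`. -/
def evTerms (L : List (ℤ × ℕ × ℕ)) (u v : ℝ) : ℝ :=
  (L.map fun t => (t.1 : ℝ) * u ^ t.2.1 * v ^ t.2.2).sum

theorem ev_ofTerms (L : List (ℤ × ℕ × ℕ)) (u v : ℝ) : ev (ofTerms L) u v = evTerms L u v := by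
  induction L with
  | nil => simp [ofTerms, ev, evTerms]
  | cons t L ih =>
    rw [ofTerms, ev_add, ih, ev_replicate, evRow_replicate]
    simp only [evTerms, List.map_cons, List.sum_cons]
    ring

theorem evTerms_nonneg_of_checkSquare {n w : ℕ} {L : List (ℤ × ℕ × ℕ)}
    (h : checkSquare n w (ofTerms L) = true) {u v : ℝ} (hu : 0 ≤ u) (huw : u ≤ w) (hv : 0 ≤ v)
    (hvw : v ≤ w) : 0 ≤ evTerms L u v := by
  obtain ⟨Q, hQ, hkQ⟩ := shiftThen_spec w w (ofTerms L)
  obtain ⟨R, hR, hkR⟩ := flipVThen_spec Q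
  obtain ⟨S, hS, hkS⟩ := flipUThen_spec R false
  rw [checkSquare, hkQ, hkR, hkS] at h
  have := ev_nonneg_of_check h (u := w - u) (v := w - v) (by linarith) (by linarith) (by linarith)
    (by linarith)
  rw [hS, hR, hQ, cond_false, one_mul, ev_ofTerms] at this
  convert this using 2 <;> ring

end IntPoly

namespace Bacciotti

/-- The terms of the higher order part of the Lyapunov function. -/
def lyapunovTerms : List (ℤ × ℕ × ℕ) :=
  [(-1040, 1, 5), (-1339, 3, 1), (267, 0, 8), (819, 2, 4), (1043, 4, 0), (577, 1, 7), (263, 3, 3),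
    (1792, 0, 10), (4302, 2, 6), (4257, 4, 2), (-8407, 1, 9), (-12000, 3, 5), (-6180, 5, 1),
    (-1599, 0, 12), (8193, 2, 8), (10202, 4, 4), (449, 6, 0), (5452, 1, 11), (-8191, 3, 7),
    (-12000, 5, 3), (-3052, 2, 10), (12000, 4, 6), (10025, 6, 2), (3881, 5, 5), (2694, 7, 1),
    (-7602, 6, 4), (-1943, 8, 0), (-10863, 5, 7), (-4592, 7, 3), (12000, 6, 6), (1491, 10, 0),
    (-1544, 9, 3)]

/-- For `b = p / q`, the terms of `-q (W' + (x⁴ + y⁸)(2 - x² - y²))`, where `W'` is the derivative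
of `W = 500 x² + 250 b y⁴ + ∑ c xⁱ yʲ` along `(b (y³ - x³), -x + y⁵)`. -/
def decayTerms (p q : ℤ) (L : List (ℤ × ℕ × ℕ)) : List (ℤ × ℕ × ℕ) :=
  [(1000 * p - 2 * q, 4, 0), (-1000 * p - 2 * q, 0, 8), (q, 6, 0), (q, 4, 2), (q, 2, 8),
    (q, 0, 10)] ++
  L.flatMap fun t => [(-p * t.1 * t.2.1, t.2.1 - 1, t.2.2 + 3), (p * t.1 * t.2.1, t.2.1 + 2, t.2.2),
    (q * t.1 * t.2.2, t.2.1 + 1, t.2.2 - 1), (-q * t.1 * t.2.2, t.2.1, t.2.2 + 4)]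

/-- Terms of a polynomial in a weighted blow-up chart at the origin, divided by the eighth power of
the first variable and with both variables scaled by `127`. -/
def chartTerms (s : ℤ) (f : ℕ → ℕ → ℕ) (L : List (ℤ × ℕ × ℕ)) : List (ℤ × ℕ × ℕ) :=
  L.map fun t => (t.1 * s ^ t.2.1 * 127 ^ (28 - (2 * t.2.1 + t.2.2 - 8 + f t.2.1 t.2.2)),
    2 * t.2.1 + t.2.2 - 8, f t.2.1 t.2.2)

open IntPoly

theorem evTerms_cons (t : ℤ × ℕ × ℕ) (L : List (ℤ × ℕ × ℕ)) (x y : ℝ) :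
    evTerms (t :: L) x y = t.1 * x ^ t.2.1 * y ^ t.2.2 + evTerms L x y := rfl

theorem evTerms_append (L M : List (ℤ × ℕ × ℕ)) (x y : ℝ) :
    evTerms (L ++ M) x y = evTerms L x y + evTerms M x y := by
  simp [evTerms]

theorem evTerms_neg_neg {L : List (ℤ × ℕ × ℕ)} (hL : ∀ t ∈ L, t.1 = 0 ∨ Even (t.2.1 + t.2.2))
    (x y : ℝ) : evTerms L (-x) (-y) = evTerms L x y := by
  unfold evTerms
  congr 1
  refine List.map_congr_left fun t ht => ?_
  rcases hL t ht with h | h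
  · simp [h]
  · rw [neg_pow x, neg_pow y]
    linear_combination (t.1 * x ^ t.2.1 * y ^ t.2.2 : ℝ) * ((pow_add (-1 : ℝ) _ _).symm.trans
      h.neg_one_pow)

theorem evTerms_chartTerms {L : List (ℤ × ℕ × ℕ)} {s : ℤ} {f : ℕ → ℕ → ℕ}
    (hL : ∀ t ∈ L, t.1 = 0 ∨
      8 ≤ 2 * t.2.1 + t.2.2 ∧ 2 * t.2.1 + t.2.2 - 8 + f t.2.1 t.2.2 ≤ 28)
    {x y u v : ℝ} (h : ∀ i j, x ^ i * y ^ j = s ^ i * u ^ (2 * i + j) * v ^ f i j) :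
    127 ^ 28 * evTerms L x y = u ^ 8 * evTerms (chartTerms s f L) (127 * u) (127 * v) := by
  induction L with
  | nil => simp [evTerms, chartTerms]
  | cons t L ih =>
    have ih := ih fun t ht => hL t (List.mem_cons_of_mem _ ht)
    rw [chartTerms, List.map_cons, evTerms_cons, evTerms_cons, mul_add, mul_add, ← chartTerms, ih,
      mul_assoc (t.1 : ℝ), h]
    congr 1
    rcases hL t List.mem_cons_self with h0 | ⟨h8, h28⟩
    · simp [h0]
    · obtain ⟨k, hk⟩ := Nat.exists_eq_add_of_le h8
      obtain ⟨l, hl⟩ := Nat.exists_eq_add_of_le h28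
      have hk' : 2 * t.2.1 + t.2.2 - 8 = k := by omega
      rw [hk'] at hl ⊢
      have hl' : 28 - (k + f t.2.1 t.2.2) = l := by omega
      rw [hl', hk, hl]
      push_cast
      ring

/-- The exponents occurring in `L` are compatible with `chartTerms`. -/
abbrev Admissible (L : List (ℤ × ℕ × ℕ)) : Prop :=
  ∀ t ∈ L, t.1 = 0 ∨ Even (t.2.1 + t.2.2) ∧ 8 ≤ 2 * t.2.1 + t.2.2 ∧
    2 * t.2.1 + t.2.2 - 8 + max t.2.1 t.2.2 ≤ 28

theorem evTerms_nonneg_of_chart {L : List (ℤ × ℕ × ℕ)} (hL : Admissible L) {s : ℤ}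
    (hs : s * s = 1) {n : ℕ}
    (h₁ : checkSquare n 127 (ofTerms (chartTerms s (fun i _ => i) L)) = true)
    (h₂ : checkSquare n 127 (ofTerms (chartTerms s (fun _ j => j) L)) = true)
    {x y : ℝ} (hx : 0 ≤ s * x) (hx1 : s * x ≤ 1) (hy : 0 ≤ y) (hy1 : y ≤ 1) :
    0 ≤ evTerms L x y := by
  have hs' : (s * s : ℝ) = 1 := by exact_mod_cast hs
  have key {f : ℕ → ℕ → ℕ} (hf : ∀ i j, f i j ≤ max i j)
      (hc : checkSquare n 127 (ofTerms (chartTerms s f L)) = true) {u v : ℝ} (hu : 0 ≤ u)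
      (hu1 : u ≤ 1) (hv : 0 ≤ v) (hv1 : v ≤ 1)
      (h : ∀ i j, x ^ i * y ^ j = s ^ i * u ^ (2 * i + j) * v ^ f i j) : 0 ≤ evTerms L x y := by
    have h1 := evTerms_chartTerms (L := L) (fun t ht => (hL t ht).imp id fun h =>
      ⟨h.2.1, le_trans (by have := hf t.2.1 t.2.2; omega) h.2.2⟩) h
    have h2 := evTerms_nonneg_of_checkSquare hc (u := 127 * u) (v := 127 * v) (by positivity)
      (by push_cast; linarith) (by positivity) (by push_cast; linarith)
    have h3 : 0 ≤ (127 : ℝ) ^ 28 * evTerms L x y := h1 ▸ mul_nonneg (by positivity) h2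
    exact nonneg_of_mul_nonneg_right h3 (by positivity)
  rcases le_or_gt (s * x) (y ^ 2) with h | h
  · have hx2 : x = s * y ^ 2 * (s * x / y ^ 2) := by
      rcases eq_or_ne y 0 with rfl | hy0
      · have : (s : ℝ) * x = 0 := le_antisymm (by simpa using h) hx
        have hsx : x = s * (s * x) := by linear_combination -x * hs'
        rw [hsx, this]
        simp
      · field_simp
        linear_combination -x * hs'
    refine key (fun i j => le_max_left i j) h₁ hy hy1 (v := s * x / y ^ 2) (by positivity)
      (div_le_one_of_le₀ h (by positivity)) fun i j => ?_
    conv_lhs => rw [hx2]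
    simp only [mul_pow]
    ring
  · have hpos : 0 < s * x := lt_of_le_of_lt (by positivity) h
    have hu := Real.sq_sqrt hx
    have hu0 : 0 < √(s * x) := Real.sqrt_pos.mpr hpos
    refine key (fun i j => le_max_right i j) h₂ hu0.le (Real.sqrt_le_one.mpr hx1)
      (v := y / √(s * x)) (by positivity)
      (div_le_one_of_le₀ (Real.le_sqrt_of_sq_le h.le) hu0.le) fun i j => ?_
    have hx2 : x = s * √(s * x) ^ 2 := by rw [hu]; linear_combination -x * hs'
    have hy2 : y = √(s * x) * (y / √(s * x)) := by field_simp
    conv_lhs => rw [hy2]; enter [1]; rw [hx2]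
    simp only [mul_pow]
    ring

theorem evTerms_nonneg {L : List (ℤ × ℕ × ℕ)} (hL : Admissible L) {n : ℕ}
    (h₁ : checkSquare n 127 (ofTerms (chartTerms 1 (fun i _ => i) L)) = true)
    (h₂ : checkSquare n 127 (ofTerms (chartTerms 1 (fun _ j => j) L)) = true)
    (h₃ : checkSquare n 127 (ofTerms (chartTerms (-1) (fun i _ => i) L)) = true)
    (h₄ : checkSquare n 127 (ofTerms (chartTerms (-1) (fun _ j => j) L)) = true)
    {x y : ℝ} (hx : |x| ≤ 1) (hy : |y| ≤ 1) : 0 ≤ evTerms L x y := by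
  wlog hy0 : 0 ≤ y generalizing x y
  · rw [← evTerms_neg_neg fun t ht => (hL t ht).imp id And.left]
    exact this (by rwa [abs_neg]) (by rwa [abs_neg]) (by linarith)
  rw [abs_le] at hx hy
  rcases le_total 0 x with hx0 | hx0
  · exact evTerms_nonneg_of_chart hL (s := 1) rfl h₁ h₂ (by simpa) (by simpa using hx.2) hy0 hy.2
  · exact evTerms_nonneg_of_chart hL (s := -1) rfl h₃ h₄ (by simpa) (by simpa using by linarith)
      hy0 hy.2

/-- The partial derivative of `evTerms` with respect to the first variable. -/
def evTermsX (L : List (ℤ × ℕ × ℕ)) (x y : ℝ) : ℝ :=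
  (L.map fun t => (t.1 : ℝ) * t.2.1 * x ^ (t.2.1 - 1) * y ^ t.2.2).sum

/-- The partial derivative of `evTerms` with respect to the second variable. -/
def evTermsY (L : List (ℤ × ℕ × ℕ)) (x y : ℝ) : ℝ :=
  (L.map fun t => (t.1 : ℝ) * t.2.2 * x ^ t.2.1 * y ^ (t.2.2 - 1)).sum

theorem hasDerivAt_evTerms (L : List (ℤ × ℕ × ℕ)) {x y : ℝ → ℝ} {x' y' t : ℝ}
    (hx : HasDerivAt x x' t) (hy : HasDerivAt y y' t) :
    HasDerivAt (fun t => evTerms L (x t) (y t))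
      (evTermsX L (x t) (y t) * x' + evTermsY L (x t) (y t) * y') t := by
  induction L with
  | nil => simpa [evTerms, evTermsX, evTermsY] using hasDerivAt_const t (0 : ℝ)
  | cons a L ih =>
    simp only [evTerms_cons]
    refine ((((hx.pow a.2.1).const_mul (a.1 : ℝ)).mul (hy.pow a.2.2)).add ih).congr_deriv ?_
    simp only [evTermsX, evTermsY, List.map_cons, List.sum_cons, Pi.pow_apply]
    ring

/-- The guaranteed rate of decay of the Lyapunov function. -/
def decay (x y : ℝ) : ℝ := (x ^ 4 + y ^ 8) * (2 - x ^ 2 - y ^ 2)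

theorem evTerms_decayTerms (p q : ℤ) (L : List (ℤ × ℕ × ℕ)) (x y : ℝ) :
    evTerms (decayTerms p q L) x y =
      -(p * (1000 * (y ^ 8 - x ^ 4) + evTermsX L x y * (y ^ 3 - x ^ 3)) +
        q * (evTermsY L x y * (-x + y ^ 5))) - q * decay x y := by
  have h : evTerms (L.flatMap fun t => [(-p * t.1 * t.2.1, t.2.1 - 1, t.2.2 + 3),
      (p * t.1 * t.2.1, t.2.1 + 2, t.2.2), (q * t.1 * t.2.2, t.2.1 + 1, t.2.2 - 1),
      (-q * t.1 * t.2.2, t.2.1, t.2.2 + 4)]) x y =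
      -(p * (evTermsX L x y * (y ^ 3 - x ^ 3)) + q * (evTermsY L x y * (-x + y ^ 5))) := by
    induction L with
    | nil => simp [evTerms, evTermsX, evTermsY]
    | cons t L ih =>
      rw [List.flatMap_cons, evTerms_append, ih]
      obtain ⟨c, i, j⟩ := t
      simp only [evTerms, evTermsX, evTermsY, List.map_cons, List.sum_cons, List.map_nil,
        List.sum_nil]
      cases i <;> cases j <;> push_cast <;> ring
  rw [decayTerms, evTerms_append, h]
  simp only [evTerms, decay, List.map_cons, List.sum_cons, List.map_nil, List.sum_nil]
  push_cast
  ring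

theorem checkSquare_low_pos_steep : checkSquare 9 127
    (ofTerms (chartTerms 1 (fun i _ => i) (decayTerms 707 500 lyapunovTerms))) = true := by
  decide +kernel

theorem checkSquare_low_pos_flat : checkSquare 9 127
    (ofTerms (chartTerms 1 (fun _ j => j) (decayTerms 707 500 lyapunovTerms))) = true := by
  decide +kernel

theorem checkSquare_low_neg_steep : checkSquare 9 127
    (ofTerms (chartTerms (-1) (fun i _ => i) (decayTerms 707 500 lyapunovTerms))) = true := by
  decide +kernel

theorem checkSquare_low_neg_flat : checkSquare 9 127
    (ofTerms (chartTerms (-1) (fun _ j => j) (decayTerms 707 500 lyapunovTerms))) = true := by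
  decide +kernel

theorem checkSquare_high_pos_steep : checkSquare 9 127
    (ofTerms (chartTerms 1 (fun i _ => i) (decayTerms 5 3 lyapunovTerms))) = true := by
  decide +kernel

theorem checkSquare_high_pos_flat : checkSquare 9 127
    (ofTerms (chartTerms 1 (fun _ j => j) (decayTerms 5 3 lyapunovTerms))) = true := by
  decide +kernel

theorem checkSquare_high_neg_steep : checkSquare 9 127
    (ofTerms (chartTerms (-1) (fun i _ => i) (decayTerms 5 3 lyapunovTerms))) = true := by
  decide +kernel

theorem checkSquare_high_neg_flat : checkSquare 9 127
    (ofTerms (chartTerms (-1) (fun _ j => j) (decayTerms 5 3 lyapunovTerms))) = true := by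
  decide +kernel

theorem decayTerms_low_nonneg {x y : ℝ} (hx : |x| ≤ 1) (hy : |y| ≤ 1) :
    0 ≤ evTerms (decayTerms 707 500 lyapunovTerms) x y :=
  evTerms_nonneg (by decide +kernel) checkSquare_low_pos_steep checkSquare_low_pos_flat
    checkSquare_low_neg_steep checkSquare_low_neg_flat hx hy

theorem decayTerms_high_nonneg {x y : ℝ} (hx : |x| ≤ 1) (hy : |y| ≤ 1) :
    0 ≤ evTerms (decayTerms 5 3 lyapunovTerms) x y :=
  evTerms_nonneg (by decide +kernel) checkSquare_high_pos_steep checkSquare_high_pos_flat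
    checkSquare_high_neg_steep checkSquare_high_neg_flat hx hy

theorem lyapunov_deriv_le {b x y : ℝ} (hb₁ : 707 / 500 ≤ b) (hb₂ : b ≤ 5 / 3) (hx : |x| ≤ 1)
    (hy : |y| ≤ 1) :
    b * (1000 * (y ^ 8 - x ^ 4) + evTermsX lyapunovTerms x y * (y ^ 3 - x ^ 3)) +
      evTermsY lyapunovTerms x y * (-x + y ^ 5) ≤ -decay x y := by
  have h₁ := decayTerms_low_nonneg hx hy
  have h₂ := decayTerms_high_nonneg hx hy
  rw [evTerms_decayTerms] at h₁ h₂
  push_cast at h₁ h₂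
  generalize 1000 * (y ^ 8 - x ^ 4) + evTermsX lyapunovTerms x y * (y ^ 3 - x ^ 3) = S at h₁ h₂ ⊢
  rcases le_total 0 S with hS | hS
  · linarith [mul_le_mul_of_nonneg_right hb₂ hS]
  · linarith [mul_le_mul_of_nonpos_right hb₁ hS]

theorem decay_nonneg {x y : ℝ} (hx : |x| ≤ 1) (hy : |y| ≤ 1) : 0 ≤ decay x y := by
  rw [← sq_le_one_iff_abs_le_one] at hx hy
  exact mul_nonneg (by positivity) (by linarith)

theorem mem_of_decay_nonpos {x y : ℝ} (hx : |x| ≤ 1) (hy : |y| ≤ 1) (h : decay x y ≤ 0) :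
    x ∈ ({-1, 0, 1} : Set ℝ) ∧ y ∈ ({-1, 0, 1} : Set ℝ) := by
  have h0 : decay x y = 0 := le_antisymm h (decay_nonneg hx hy)
  rw [← sq_le_one_iff_abs_le_one] at hx hy
  simp only [mem_insert_iff, mem_singleton_iff]
  rcases mul_eq_zero.mp h0 with h0 | h0
  · have hx4 : x ^ 4 = 0 := le_antisymm (by linarith [show 0 ≤ y ^ 8 by positivity]) (by positivity)
    have hy8 : y ^ 8 = 0 := by linarith
    exact ⟨.inr (.inl (pow_eq_zero_iff (by norm_num) |>.mp hx4)),
      .inr (.inl (pow_eq_zero_iff (by norm_num) |>.mp hy8))⟩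
  · have hx2 : x ^ 2 = 1 := by linarith
    have hy2 : y ^ 2 = 1 := by linarith
    rw [← one_pow 2, sq_eq_sq_iff_eq_or_eq_neg] at hx2 hy2
    tauto

/-- The Lyapunov function. -/
@[irreducible]
def lyapunov (b x y : ℝ) : ℝ :=
  500 * x ^ 2 + 250 * b * y ^ 4 + evTerms lyapunovTerms x y

theorem lyapunov_neg_neg (b x y : ℝ) : lyapunov b (-x) (-y) = lyapunov b x y := by
  have h : ∀ t ∈ lyapunovTerms, t.1 = 0 ∨ Even (t.2.1 + t.2.2) := by decide +kernel
  rw [lyapunov, lyapunov, evTerms_neg_neg h]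
  ring

theorem continuous_evTerms (L : List (ℤ × ℕ × ℕ)) :
    Continuous fun p : ℝ × ℝ => evTerms L p.1 p.2 := by
  induction L with
  | nil => exact continuous_const
  | cons t L ih =>
    simp only [evTerms_cons]
    fun_prop

theorem continuous_lyapunov (b : ℝ) : Continuous fun p : ℝ × ℝ => lyapunov b p.1 p.2 := by
  have := continuous_evTerms lyapunovTerms
  unfold lyapunov
  fun_prop

theorem tendsto_lyapunov (b : ℝ) {x y : ℝ → ℝ} {l : Filter ℝ} {u v : ℝ}
    (hx : Tendsto x l (nhds u)) (hy : Tendsto y l (nhds v)) :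
    Tendsto (fun t => lyapunov b (x t) (y t)) l (nhds (lyapunov b u v)) :=
  ((continuous_lyapunov b).tendsto (u, v)).comp (hx.prodMk_nhds hy)

/-- A solution of Bacciotti's system in coordinates where the equilibria are `±(1, 1)`. -/
structure IsScaledSolution (b : ℝ) (x y : ℝ → ℝ) : Prop where
  hasDerivAt_fst (t : ℝ) : HasDerivAt x (b * (y t ^ 3 - x t ^ 3)) t
  hasDerivAt_snd (t : ℝ) : HasDerivAt y (-x t + y t ^ 5) t

theorem _root_.HasDerivAt.eq_zero_of_forall_abs_le {f : ℝ → ℝ} {f' t : ℝ} (hf : HasDerivAt f f' t)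
    (h : ∀ s, |f s| ≤ |f t|) (ht : f t ≠ 0) : f' = 0 := by
  have hloc : IsLocalMax (fun s => f s ^ 2) t := Filter.Eventually.of_forall fun s =>
    sq_le_sq.mpr (h s)
  have := hloc.hasDerivAt_eq_zero (hf.pow 2)
  simpa [ht] using this

namespace IsScaledSolution

variable {b : ℝ} {x y : ℝ → ℝ}

theorem continuous_fst (h : IsScaledSolution b x y) : Continuous x :=
  continuous_iff_continuousAt.mpr fun t => (h.hasDerivAt_fst t).continuousAt

theorem continuous_snd (h : IsScaledSolution b x y) : Continuous y :=
  continuous_iff_continuousAt.mpr fun t => (h.hasDerivAt_snd t).continuousAt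

theorem le_one_of_isMax (h : IsScaledSolution b x y) (hb : b ≠ 0) {t : ℝ}
    (ht : ∀ s, max |x s| |y s| ≤ max |x t| |y t|) : max |x t| |y t| ≤ 1 := by
  by_contra! hS
  have key (hy : max |x t| |y t| = |y t|) : False := by
    rw [hy] at ht hS
    have h0 := (h.hasDerivAt_snd t).eq_zero_of_forall_abs_le
      (fun s => (le_max_right _ _).trans (ht s)) (abs_pos.mp (by linarith))
    have hx : |x t| = |y t| ^ 5 := by
      rw [← abs_pow]
      congr 1
      linarith
    have h1 : |y t| ^ 1 < |y t| ^ 5 := pow_lt_pow_right₀ hS (by norm_num)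
    have h2 := (le_max_left _ _).trans (ht t)
    linarith
  rcases max_choice |x t| |y t| with hx | hy
  · rw [hx] at ht hS
    have h0 := (h.hasDerivAt_fst t).eq_zero_of_forall_abs_le
      (fun s => (le_max_left _ _).trans (ht s)) (abs_pos.mp (by linarith))
    have hxy : y t = x t := by
      have : y t ^ 3 = x t ^ 3 := by
        have := (mul_eq_zero.mp h0).resolve_left hb
        linarith
      exact (Odd.strictMono_pow (by decide : Odd 3)).injective this
    exact key (by rw [hxy, max_self])
  · exact key hy

theorem hasDerivAt_lyapunov (h : IsScaledSolution b x y) (t : ℝ) :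
    HasDerivAt (fun t => lyapunov b (x t) (y t))
      (b * (1000 * (y t ^ 8 - x t ^ 4) +
          evTermsX lyapunovTerms (x t) (y t) * (y t ^ 3 - x t ^ 3)) +
        evTermsY lyapunovTerms (x t) (y t) * (-x t + y t ^ 5)) t := by
  have hx := h.hasDerivAt_fst t
  have hy := h.hasDerivAt_snd t
  simp only [lyapunov]
  refine ((((hx.pow 2).const_mul 500).add ((hy.pow 4).const_mul (250 * b))).add
    (hasDerivAt_evTerms lyapunovTerms hx hy)).congr_deriv ?_
  push_cast
  ring

theorem lyapunov_antitone (h : IsScaledSolution b x y) (hb₁ : 707 / 500 ≤ b) (hb₂ : b ≤ 5 / 3)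
    (hx : ∀ t, |x t| ≤ 1) (hy : ∀ t, |y t| ≤ 1) :
    Antitone fun t => lyapunov b (x t) (y t) := by
  refine antitone_of_hasDerivAt_nonpos h.hasDerivAt_lyapunov fun t => ?_
  exact (lyapunov_deriv_le hb₁ hb₂ (hx t) (hy t)).trans (neg_nonpos.mpr
    (decay_nonneg (hx t) (hy t)))

theorem eq_const_of_lyapunov (h : IsScaledSolution b x y) (hb₁ : 707 / 500 ≤ b) (hb₂ : b ≤ 5 / 3)
    (hx : ∀ t, |x t| ≤ 1) (hy : ∀ t, |y t| ≤ 1) {c : ℝ}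
    (hc : ∀ t, lyapunov b (x t) (y t) = c) (s t : ℝ) : x s = x t ∧ y s = y t := by
  have hw (t : ℝ) : x t ∈ ({-1, 0, 1} : Set ℝ) ∧ y t ∈ ({-1, 0, 1} : Set ℝ) := by
    have h1 := h.hasDerivAt_lyapunov t
    simp only [hc] at h1
    have h2 := lyapunov_deriv_le hb₁ hb₂ (hx t) (hy t)
    rw [h1.unique (hasDerivAt_const t c)] at h2
    exact mem_of_decay_nonpos (hx t) (hy t) (by linarith)
  have hd : IsDiscrete ({-1, 0, 1} : Set ℝ) := (Set.toFinite _).isDiscrete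
  exact ⟨isPreconnected_univ.constant_of_mapsTo hd h.continuous_fst.continuousOn
      (fun t _ => (hw t).1) (mem_univ s) (mem_univ t),
    isPreconnected_univ.constant_of_mapsTo hd h.continuous_snd.continuousOn
      (fun t _ => (hw t).2) (mem_univ s) (mem_univ t)⟩

theorem eq_const_of_periodic (h : IsScaledSolution b x y) (hb₁ : 707 / 500 ≤ b) (hb₂ : b ≤ 5 / 3)
    {T : ℝ} (hT : 0 < T) (hxT : Function.Periodic x T) (hyT : Function.Periodic y T) (s t : ℝ) :
    x s = x t ∧ y s = y t := by
  have hbox : ∀ t, max |x t| |y t| ≤ 1 := by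
    obtain ⟨t₀, -, h₀⟩ := isCompact_Icc.exists_isMaxOn (nonempty_Icc.mpr hT.le)
      (h.continuous_fst.abs.max h.continuous_snd.abs).continuousOn
    have hper : Function.Periodic (fun t => max |x t| |y t|) T := fun t => by
      simp only [hxT t, hyT t]
    have hmax (s : ℝ) : max |x s| |y s| ≤ max |x t₀| |y t₀| := by
      obtain ⟨r, hr, hrs⟩ := hper.exists_mem_Ico₀ hT s
      rw [hrs]
      exact h₀ (Ico_subset_Icc_self hr)
    exact fun t => (hmax t).trans (h.le_one_of_isMax (by linarith) hmax)
  have hx t := (le_max_left _ _).trans (hbox t)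
  have hy t := (le_max_right _ _).trans (hbox t)
  have hanti := h.lyapunov_antitone hb₁ hb₂ hx hy
  have hper : Function.Periodic (fun t => lyapunov b (x t) (y t)) T := fun t => by
    simp only [hxT t, hyT t]
  have hle (r s : ℝ) : lyapunov b (x r) (y r) ≤ lyapunov b (x s) (y s) := by
    obtain ⟨n, hn⟩ := exists_nat_gt ((s - r) / T)
    have h1 := hper.nat_mul n r
    rw [← h1]
    refine hanti ?_
    rw [div_lt_iff₀ hT] at hn
    linarith
  exact h.eq_const_of_lyapunov hb₁ hb₂ hx hy (fun r => le_antisymm (hle r 0) (hle 0 r)) s t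

theorem not_tendsto (h : IsScaledSolution b x y) (hb₁ : 707 / 500 ≤ b) (hb₂ : b ≤ 5 / 3)
    (hx₁ : Tendsto x atBot (nhds (-1))) (hy₁ : Tendsto y atBot (nhds (-1)))
    (hx₂ : Tendsto x atTop (nhds 1)) (hy₂ : Tendsto y atTop (nhds 1)) : False := by
  have hbox : ∀ t, max |x t| |y t| ≤ 1 := by
    by_contra! hex
    obtain ⟨t₁, h₁⟩ := hex
    have hM : Tendsto (fun t => max |x t| |y t|) (cocompact ℝ) (nhds 1) := by
      rw [cocompact_eq_atBot_atTop]
      exact Tendsto.sup (by simpa using hx₁.abs.max hy₁.abs) (by simpa using hx₂.abs.max hy₂.abs)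
    obtain ⟨t₀, h₀⟩ := (h.continuous_fst.abs.max h.continuous_snd.abs).exists_forall_ge' t₁
      ((hM.eventually_lt_const h₁).mono fun _ h => h.le)
    exact absurd (h.le_one_of_isMax (by linarith) h₀) (not_le.mpr (h₁.trans_le (h₀ t₁)))
  have hx t := (le_max_left _ _).trans (hbox t)
  have hy t := (le_max_right _ _).trans (hbox t)
  have hanti := h.lyapunov_antitone hb₁ hb₂ hx hy
  have hbot : Tendsto (fun t => lyapunov b (x t) (y t)) atBot (nhds (lyapunov b 1 1)) := by
    rw [← lyapunov_neg_neg]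
    exact tendsto_lyapunov b hx₁ hy₁
  have htop : Tendsto (fun t => lyapunov b (x t) (y t)) atTop (nhds (lyapunov b 1 1)) :=
    tendsto_lyapunov b hx₂ hy₂
  have hconst := h.eq_const_of_lyapunov hb₁ hb₂ hx hy fun t =>
    le_antisymm (hanti.ge_of_tendsto hbot t) (hanti.le_of_tendsto htop t)
  have hx0 : x = fun _ => x 0 := funext fun t => (hconst t 0).1
  rw [hx0, tendsto_const_nhds_iff] at hx₁ hx₂
  linarith

end IsScaledSolution

theorem isScaledSolution {m a : ℝ} (ha : a ≠ 0) (ham : a ^ 4 * m = 1) {γ : ℝ → ℝ × ℝ}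
    (h : IsSolution m γ) :
    IsScaledSolution (a ^ 2) (fun t => (γ t).1 / a) (fun t => (γ t).2 / a) where
  hasDerivAt_fst t := by
    have h1 : HasDerivAt (fun t => (γ t).1) _ t :=
      (hasFDerivAt_fst (𝕜 := ℝ) (p := γ t)).comp_hasDerivAt t (h t)
    refine (h1.div_const a).congr_deriv ?_
    simp only [bacciotti, ContinuousLinearMap.coe_fst']
    field_simp
  hasDerivAt_snd t := by
    have h1 : HasDerivAt (fun t => (γ t).2) _ t :=
      (hasFDerivAt_snd (𝕜 := ℝ) (p := γ t)).comp_hasDerivAt t (h t)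
    refine (h1.div_const a).congr_deriv ?_
    simp only [bacciotti, ContinuousLinearMap.coe_snd']
    field_simp
    linear_combination (γ t).2 ^ 5 * ham

end Bacciotti

theorem bacciotti_no_cycles_middle_m (m : ℝ) (hm₁ : 9 / 25 < m) (hm₂ : m < 1 / 2) :
    (¬ ∃ (γ : ℝ → ℝ × ℝ) (T : ℝ), IsPeriodicOrbit m γ T) ∧
    (¬ ∃ γ : ℝ → ℝ × ℝ, IsHeteroclinic m γ) := by
  have hm : 0 < m := by linarith
  obtain ⟨a, ha⟩ : ∃ a, a = m ^ (-(1 : ℝ) / 4) := ⟨_, rfl⟩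
  have ha0 : 0 < a := ha ▸ Real.rpow_pos_of_pos hm _
  have ham : a ^ 4 * m = 1 := by
    rw [ha, ← Real.rpow_natCast, ← Real.rpow_mul hm.le]
    norm_num [Real.rpow_neg_one, hm.ne']
  have hb₁ : 707 / 500 ≤ a ^ 2 := by
    by_contra! hlt
    have : (a ^ 2) ^ 2 ≤ (707 / 500) ^ 2 := by gcongr
    nlinarith
  have hb₂ : a ^ 2 ≤ 5 / 3 := by
    by_contra! hlt
    have : (5 / 3) ^ 2 ≤ (a ^ 2) ^ 2 := by gcongr
    nlinarith
  refine ⟨?_, ?_⟩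
  · rintro ⟨γ, T, hγ, hne, hT, hper⟩
    have hconst := (Bacciotti.isScaledSolution ha0.ne' ham hγ).eq_const_of_periodic hb₁ hb₂ hT
      (fun t => by simp only [hper t]) (fun t => by simp only [hper t])
    refine hne ⟨γ 0, fun t => Prod.ext ?_ ?_⟩
    · exact (div_left_inj' ha0.ne').mp (hconst t 0).1
    · exact (div_left_inj' ha0.ne').mp (hconst t 0).2
  · rintro ⟨γ, hγ, hbot, htop⟩
    rw [pMinus, ← ha] at hbot
    rw [pPlus, ← ha] at htop
    have hdiv : a / a = 1 := div_self ha0.ne'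
    have h1 := (hbot.fst_nhds).div_const a
    have h2 := (hbot.snd_nhds).div_const a
    have h3 := (htop.fst_nhds).div_const a
    have h4 := (htop.snd_nhds).div_const a
    simp only [neg_div, hdiv] at h1 h2 h3 h4
    exact (Bacciotti.isScaledSolution ha0.ne' ham hγ).not_tendsto hb₁ hb₂ h1 h2 h3 h4

end
end

section
/- For every m ∈ [0.5, 0.547], Bacciotti's system X_m has no periodic orbit and no heteroclinic connection. -/
open Real Filter Set

noncomputable section

/-- The coefficients of `c + (k * X + 1) * l`, where `scale` multiplies by `k`. -/
def hornerStep {C : Type} (add : C → C → C) (scale : C → C) (l : List C) : C → List C :=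
  List.rec (motive := fun _ => C → List C) (fun c => [c])
    (fun a _ ih c => add c a :: ih (scale a)) l

/-- Substitute `x ↦ w + k * x` in a homogeneous form `∑ cᵢ xⁱ wⁿ⁻ⁱ`. -/
def shift {C : Type} (add : C → C → C) (scale : C → C) (l : List C) : List C :=
  List.rec (motive := fun _ => List C) []
    (fun c _ ih => hornerStep add scale ih c) l

def mapRec {C D : Type} (f : C → D) (l : List C) : List D :=
  List.rec (motive := fun _ => List D) [] (fun c _ ih => f c :: ih) l

def addRow (l : List ℕ) : List ℕ → List ℕ :=
  List.rec (motive := fun _ => List ℕ → List ℕ) (fun r => r)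
    (fun a l ih r => List.rec (motive := fun _ => List ℕ) (a :: l)
      (fun b r' _ => Nat.add a b :: ih r') r) l

def leList {C : Type} (le : C → C → Bool) (l : List C) : List C → Bool :=
  List.rec (motive := fun _ => List C → Bool) (fun _ => true)
    (fun a _ ih r => List.rec (motive := fun _ => Bool) false
      (fun b r' _ => (le a b).rec false (ih r')) r) l

def shiftInner (k : ℕ) (l : List ℕ) : List ℕ := shift Nat.add (Nat.mul k) l

def shiftOuter (k : ℕ) (M : List (List ℕ)) : List (List ℕ) :=
  shift addRow (mapRec (Nat.mul k)) M

/-- A binary subdivision of the unit square. -/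
inductive Subdivision
  | leaf
  | outer (l r : Subdivision)
  | inner (l r : Subdivision)

def hasShape (n k : ℕ) (M : List (List ℕ)) : Bool :=
  (M.length == n + 1) && (M.all fun row => row.length == k + 1)

/-- Compare two Bernstein coefficient matrices of bidegree `(n, k)` entrywise on each cell of
a subdivision. -/
def certify (n k : ℕ) (S : Subdivision) : List (List ℕ) → List (List ℕ) → Bool :=
  Subdivision.rec (motive := fun _ => List (List ℕ) → List (List ℕ) → Bool)
    (leList (leList Nat.ble))
    (fun _ _ ihl ihr M N => hasShape n k M && hasShape n k N &&
      ihl (shiftOuter 2 M.reverse) (shiftOuter 2 N.reverse) &&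
      ihr (shiftOuter 2 M) (shiftOuter 2 N))
    (fun _ _ ihl ihr M N => hasShape n k M && hasShape n k N &&
      ihl (mapRec (fun row => shiftInner 2 row.reverse) M)
        (mapRec (fun row => shiftInner 2 row.reverse) N) &&
      ihr (mapRec (shiftInner 2) M) (mapRec (shiftInner 2) N)) S

def modifyCoeff {C : Type} (z : C) (f : C → C) : ℕ → List C → List C
  | 0, [] => [f z]
  | 0, a :: l => f a :: l
  | i + 1, [] => z :: modifyCoeff z f i []
  | i + 1, a :: l => a :: modifyCoeff z f i l

/-- The coefficient matrix of a list of terms `(i, j, c)`, with `c` read through `e`. -/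
def toMatrix (n k : ℕ) (e : ℤ → ℕ) : List (ℕ × ℕ × ℤ) → List (List ℕ)
  | [] => List.replicate (n + 1) (List.replicate (k + 1) 0)
  | (i, j, c) :: T => modifyCoeff [] (modifyCoeff 0 (· + e c) j) i (toMatrix n k e T)

/-- The (unnormalised) Bernstein coefficients on the unit square. -/
def toBernstein (n k : ℕ) (e : ℤ → ℕ) (T : List (ℕ × ℕ × ℤ)) : List (List ℕ) :=
  shiftOuter 1 (mapRec (fun row => shiftInner 1 row.reverse) (toMatrix n k e T)).reverse

/-- Certify that the polynomial with terms `T` is nonpositive on the unit square. -/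
def certifyTerms (n k : ℕ) (S : Subdivision) (T : List (ℕ × ℕ × ℤ)) : Bool :=
  hasShape n k (toMatrix n k Int.toNat T) && hasShape n k (toMatrix n k (fun c => (-c).toNat) T) &&
    certify n k S (toBernstein n k Int.toNat T) (toBernstein n k (fun c => (-c).toNat) T)

/-- The terms `(i, j, c)`, standing for `c xⁱ yʲ`, of the correction to the energy
`10000 (μ x² / 2 + y⁴ / 4)` in the Lyapunov function. -/
def lyapunovTerms : List (ℕ × ℕ × ℤ) :=
  [(3, 1, -9675), (4, 0, 24940), (1, 5, -7537), (2, 4, 30193),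
   (3, 3, 5867), (4, 2, 21939), (5, 1, -143592), (6, 0, 21397),
   (0, 8, 10643), (1, 7, -1423), (2, 6, 44077), (3, 5, -180814),
   (4, 4, 70420), (5, 3, -231424), (6, 2, 486359), (7, 1, -2473),
   (8, 0, -64030), (0, 10, 3796), (1, 9, -51757), (2, 8, -35914),
   (3, 7, -109253), (4, 6, 599999), (5, 5, -170188), (6, 4, 32077),
   (7, 3, -415350), (8, 2, -314153), (9, 1, 494360), (10, 0, -174546),
   (0, 12, 14047), (1, 11, -124486), (2, 10, 500595), (3, 9, -599940),
   (4, 8, 545440), (5, 7, -599996), (6, 6, -156494), (7, 5, -55739),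
   (8, 4, 552655), (9, 3, 593732), (10, 2, -379683), (11, 1, -599944),
   (12, 0, 392654), (0, 14, -18465), (1, 13, 126135), (2, 12, -346165),
   (3, 11, 462494), (4, 10, -586164), (5, 9, 235378), (6, 8, 599987),
   (7, 7, 55008), (8, 6, -599718), (9, 5, -599540), (10, 4, 599241),
   (11, 3, 100550), (12, 2, 372647), (13, 1, -599913), (14, 0, 178295)]

/-- `q` times the derivative along `(y³ - x³) ∂ₓ + (p / q) (y⁵ - x) ∂ᵧ`; see `fieldDeriv`. -/
def derivTerms (p q : ℤ) : List (ℕ × ℕ × ℤ) → List (ℕ × ℕ × ℤ)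
  | [] => [(4, 0, -(p * 10000)), (0, 8, p * 10000)]
  | (i, j, c) :: T => (i - 1, j + 3, q * i * c) :: (i + 2, j, -(q * i * c)) ::
      (i, j + 4, p * j * c) :: (i + 1, j - 1, -(p * j * c)) :: derivTerms p q T

/-- Blow-up `(x, y) = (σ u y², y)`, divided by `y⁸`. -/
def chartY (σ : ℤ) (T : List (ℕ × ℕ × ℤ)) : List (ℕ × ℕ × ℤ) :=
  T.map fun t => (t.1, 2 * t.1 + t.2.1 - 8, σ ^ t.1 * t.2.2)

/-- Blow-up `(x, y) = (z², σ v z)`, divided by `z⁸`. -/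
def chartX (σ : ℤ) (T : List (ℕ × ℕ × ℤ)) : List (ℕ × ℕ × ℤ) :=
  T.map fun t => (t.2.1, 2 * t.1 + t.2.1 - 8, σ ^ t.2.1 * t.2.2)

def margin : List (ℕ × ℕ × ℤ) := [(0, 0, 10000), (0, 1, -10000)]

/-- The homogeneous form `∑ φ(cᵢ) xⁱ wⁿ⁻ⁱ` with coefficient list `c`. -/
def formEval {C : Type} (φ : C → ℝ) : ℕ → List C → ℝ → ℝ → ℝ
  | _, [], _, _ => 0
  | n, c :: l, x, w => φ c * w ^ n + x * formEval φ (n - 1) l x w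

section FormEval

variable {C D : Type} {φ : C → ℝ}

theorem length_hornerStep (add : C → C → C) (scale : C → C) (l : List C) (c : C) :
    (hornerStep add scale l c).length = l.length + 1 := by
  induction l generalizing c with
  | nil => rfl
  | cons a l ih => exact congrArg (· + 1) (ih (scale a))

theorem length_shift (add : C → C → C) (scale : C → C) (l : List C) :
    (shift add scale l).length = l.length := by
  induction l with
  | nil => rfl
  | cons a l ih => exact (length_hornerStep add scale _ a).trans (congrArg (· + 1) ih)

theorem length_mapRec (f : C → D) (l : List C) : (mapRec f l).length = l.length := by
  induction l with
  | nil => rfl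
  | cons a l ih => exact congrArg (· + 1) ih

theorem formEval_hornerStep {add : C → C → C} {scale : C → C} {s : ℝ}
    (hadd : ∀ a b, φ (add a b) = φ a + φ b) (hscale : ∀ a, φ (scale a) = s * φ a)
    (e w : ℝ) (l : List C) (c : C) (n : ℕ) (hl : l.length ≤ n) :
    formEval φ n (hornerStep add scale l c) e w =
      φ c * w ^ n + (w + s * e) * formEval φ (n - 1) l e w := by
  induction l generalizing c n with
  | nil => simp [hornerStep, formEval]
  | cons a l ih =>
    obtain ⟨k, rfl⟩ : ∃ k, n = k + 1 := ⟨n - 1, by simp at hl; omega⟩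
    have hl' : l.length ≤ k := by simpa using hl
    have h := ih (scale a) k hl'
    change φ (add c a) * w ^ (k + 1) + e * formEval φ k (hornerStep add scale l (scale a)) e w
      = φ c * w ^ (k + 1) + (w + s * e) * (φ a * w ^ k + e * formEval φ (k - 1) l e w)
    rw [h, hadd, hscale]
    ring

theorem formEval_shift {add : C → C → C} {scale : C → C} {s : ℝ}
    (hadd : ∀ a b, φ (add a b) = φ a + φ b) (hscale : ∀ a, φ (scale a) = s * φ a)
    (e w : ℝ) (l : List C) (n : ℕ) (hl : l.length ≤ n + 1) :
    formEval φ n (shift add scale l) e w = formEval φ n l (w + s * e) w := by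
  induction l generalizing n with
  | nil => rfl
  | cons c l ih =>
    have hl' : l.length ≤ n := by simpa using hl
    have h := formEval_hornerStep hadd hscale e w (shift add scale l) c n
      (by rwa [length_shift])
    change formEval φ n (hornerStep add scale (shift add scale l) c) e w =
      φ c * w ^ n + (w + s * e) * formEval φ (n - 1) l (w + s * e) w
    rw [h, ih (n - 1) (by omega)]

theorem formEval_of_length_le (x w : ℝ) (l : List C) (n : ℕ) (hl : l.length ≤ n + 1) :
    formEval φ (n + 1) l x w = w * formEval φ n l x w := by
  induction l generalizing n with
  | nil => simp [formEval]
  | cons c l ih =>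
    rcases n with _ | n
    · obtain rfl : l = [] := by simpa using hl
      simp [formEval]
      ring
    · have h := ih n (by simpa using hl)
      simp only [formEval, Nat.add_sub_cancel] at h ⊢
      rw [h]
      ring

theorem formEval_concat (x w : ℝ) (l : List C) (c : C) (n : ℕ) (hl : l.length ≤ n) :
    formEval φ n (l ++ [c]) x w =
      formEval φ n l x w + φ c * x ^ l.length * w ^ (n - l.length) := by
  induction l generalizing n with
  | nil => simp [formEval]
  | cons a l ih =>
    obtain ⟨k, rfl⟩ : ∃ k, n = k + 1 := ⟨n - 1, by simp at hl; omega⟩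
    have h := ih k (by simpa using hl)
    simp only [List.cons_append, formEval, Nat.add_sub_cancel, List.length_cons,
      Nat.add_sub_add_right, pow_succ] at h ⊢
    rw [h]
    ring

theorem formEval_reverse (x w : ℝ) (l : List C) (n : ℕ) (hl : l.length = n + 1) :
    formEval φ n l.reverse x w = formEval φ n l w x := by
  induction l generalizing n with
  | nil => rfl
  | cons c l ih =>
    have hl' : l.length = n := by simpa using hl
    rw [List.reverse_cons, formEval_concat x w _ c n (by simp [hl'])]
    rcases n with _ | k
    · obtain rfl : l = [] := by simpa using hl'
      simp [formEval]
    · rw [formEval_of_length_le x w _ k (by simp [hl']), ih k hl']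
      simp only [formEval, Nat.add_sub_cancel, List.length_reverse, hl', Nat.sub_self, pow_zero]
      ring

theorem formEval_mapRec {φ : D → ℝ} (f : C → D) (n : ℕ) (l : List C) (x w : ℝ) :
    formEval φ n (mapRec f l) x w = formEval (fun c => φ (f c)) n l x w := by
  induction l generalizing n with
  | nil => rfl
  | cons c l ih => exact congrArg (φ (f c) * w ^ n + x * ·) (ih (n - 1))

theorem formEval_congr {ψ : C → ℝ} (n : ℕ) (l : List C) (x w : ℝ) (h : ∀ c ∈ l, φ c = ψ c) :
    formEval φ n l x w = formEval ψ n l x w := by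
  induction l generalizing n with
  | nil => rfl
  | cons c l ih =>
    simp only [formEval]
    rw [h c (by simp), ih (n - 1) fun a ha => h a (by simp [ha])]

theorem formEval_smul (s : ℝ) (n : ℕ) (l : List C) (x w : ℝ) :
    formEval (fun c => s * φ c) n l x w = s * formEval φ n l x w := by
  induction l generalizing n with
  | nil => simp [formEval]
  | cons c l ih =>
    simp only [formEval]
    rw [ih (n - 1)]
    ring

theorem formEval_nonneg (hφ : ∀ c, 0 ≤ φ c) (n : ℕ) (l : List C) {x w : ℝ}
    (hx : 0 ≤ x) (hw : 0 ≤ w) : 0 ≤ formEval φ n l x w := by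
  induction l generalizing n with
  | nil => exact le_rfl
  | cons c l ih => exact add_nonneg (mul_nonneg (hφ c) (pow_nonneg hw n)) (mul_nonneg hx (ih _))

theorem formEval_le_of_leList {le : C → C → Bool} (hle : ∀ a b, le a b = true → φ a ≤ φ b)
    (hφ : ∀ c, 0 ≤ φ c) {x w : ℝ} (hx : 0 ≤ x) (hw : 0 ≤ w) (l r : List C) (n : ℕ)
    (h : leList le l r = true) : formEval φ n l x w ≤ formEval φ n r x w := by
  induction l generalizing n r with
  | nil => exact formEval_nonneg hφ n r hx hw
  | cons a l ih =>
    rcases r with _ | ⟨b, r⟩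
    · exact absurd h Bool.false_ne_true
    · change ((le a b).rec false (leList le l r) : Bool) = true at h
      cases hab : le a b with
      | false => simp [hab] at h
      | true =>
        simp only [hab] at h
        exact add_le_add (mul_le_mul_of_nonneg_right (hle a b hab) (pow_nonneg hw n))
          (mul_le_mul_of_nonneg_left (ih r (n - 1) h) hx)

theorem formEval_modifyCoeff {z : C} {f : C → C} {δ : ℝ} (hz : φ z = 0)
    (hf : ∀ a, φ (f a) = φ a + δ) (x : ℝ) (l : List C) (i n : ℕ) :
    formEval φ n (modifyCoeff z f i l) x 1 = formEval φ n l x 1 + δ * x ^ i := by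
  induction i generalizing l n with
  | zero =>
    cases l
    · simp [modifyCoeff, formEval, hz, hf]
    · simp [modifyCoeff, formEval, hf]
      ring
  | succ i ih => cases l <;> simp [modifyCoeff, formEval, hz, ih, pow_succ] <;> ring

theorem formEval_replicate_zero (z : C) (hz : φ z = 0) (m n : ℕ) (x w : ℝ) :
    formEval φ n (List.replicate m z) x w = 0 := by
  induction m generalizing n with
  | zero => rfl
  | succ m ih => simp [List.replicate_succ, formEval, hz, ih]

end FormEval

theorem formEval_addRow (n : ℕ) (l r : List ℕ) (x w : ℝ) :
    formEval (Nat.cast : ℕ → ℝ) n (addRow l r) x w =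
      formEval Nat.cast n l x w + formEval Nat.cast n r x w := by
  induction l generalizing r n with
  | nil => simp [addRow, formEval]
  | cons a l ih =>
    rcases r with _ | ⟨b, r⟩
    · simp [addRow, formEval]
    · change ((a + b : ℕ) : ℝ) * w ^ n + x * formEval Nat.cast (n - 1) (addRow l r) x w =
        a * w ^ n + x * formEval Nat.cast (n - 1) l x w +
          (b * w ^ n + x * formEval Nat.cast (n - 1) r x w)
      rw [ih]
      push_cast
      ring

/-- The bihomogeneous form of bidegree `(n, k)` with coefficient matrix `M`. -/
def biEval (n k : ℕ) (M : List (List ℕ)) (x w y v : ℝ) : ℝ :=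
  formEval (fun row => formEval (Nat.cast : ℕ → ℝ) k row y v) n M x w

theorem formEval_shiftInner (s : ℕ) (e v : ℝ) (l : List ℕ) (k : ℕ) (hl : l.length ≤ k + 1) :
    formEval (Nat.cast : ℕ → ℝ) k (shiftInner s l) e v =
      formEval Nat.cast k l (v + s * e) v :=
  formEval_shift (fun a b => Nat.cast_add a b) (fun a => Nat.cast_mul s a) e v l k hl

section BiEval

variable {n k : ℕ} {M : List (List ℕ)}

theorem biEval_shiftOuter (s : ℕ) (e w y v : ℝ) (hM : M.length = n + 1) :
    biEval n k (shiftOuter s M) e w y v = biEval n k M (w + s * e) w y v :=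
  formEval_shift (fun a b => formEval_addRow k a b y v)
    (fun a => by
      rw [formEval_mapRec, ← formEval_smul]
      exact formEval_congr k a y v fun c _ => Nat.cast_mul s c) e w M n hM.le

theorem biEval_reverse (x w y v : ℝ) (hM : M.length = n + 1) :
    biEval n k M.reverse x w y v = biEval n k M w x y v :=
  formEval_reverse x w M n hM

theorem biEval_map_shiftInner (s : ℕ) (x w e v : ℝ) (hM : ∀ row ∈ M, row.length = k + 1) :
    biEval n k (mapRec (shiftInner s) M) x w e v = biEval n k M x w (v + s * e) v := by
  rw [biEval, formEval_mapRec]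
  exact formEval_congr n M x w fun row h => formEval_shiftInner s e v row k (hM row h).le

theorem biEval_map_shiftInner_reverse (s : ℕ) (x w e v : ℝ)
    (hM : ∀ row ∈ M, row.length = k + 1) :
    biEval n k (mapRec (fun row => shiftInner s row.reverse) M) x w e v =
      biEval n k M x w v (v + s * e) := by
  rw [biEval, formEval_mapRec]
  refine formEval_congr n M x w fun row h => ?_
  rw [formEval_shiftInner s e v _ k (by simp [hM row h]), formEval_reverse _ _ _ _ (hM row h)]

theorem hasShape_iff : hasShape n k M = true ↔
    M.length = n + 1 ∧ ∀ row ∈ M, row.length = k + 1 := by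
  simp [hasShape]

end BiEval

theorem biEval_le_of_certify (n k : ℕ) (S : Subdivision) (M N : List (List ℕ))
    (h : certify n k S M N = true) (x w y v : ℝ) (hx : 0 ≤ x) (hw : 0 ≤ w) (hy : 0 ≤ y)
    (hv : 0 ≤ v) : biEval n k M x w y v ≤ biEval n k N x w y v := by
  induction S generalizing M N x w y v with
  | leaf =>
    refine formEval_le_of_leList (fun a b hab => ?_)
      (fun row => formEval_nonneg (fun c => Nat.cast_nonneg c) k row hy hv) hx hw M N n h
    exact formEval_le_of_leList (fun a b hab => Nat.cast_le.2 (Nat.le_of_ble_eq_true hab))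
      (fun c => Nat.cast_nonneg c) hy hv a b k hab
  | outer l r ihl ihr =>
    have h' : (hasShape n k M && hasShape n k N &&
      certify n k l (shiftOuter 2 M.reverse) (shiftOuter 2 N.reverse) &&
      certify n k r (shiftOuter 2 M) (shiftOuter 2 N)) = true := h
    simp only [Bool.and_eq_true, hasShape_iff] at h'
    obtain ⟨⟨⟨⟨hM, -⟩, hN, -⟩, hl⟩, hr⟩ := h'
    rcases le_total x w with hxw | hxw
    · have := ihl _ _ hl ((w - x) / 2) x y v (by linarith) hx hy hv
      rw [biEval_shiftOuter _ _ _ _ _ (by simpa using hM), biEval_reverse _ _ _ _ hM,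
        biEval_shiftOuter _ _ _ _ _ (by simpa using hN), biEval_reverse _ _ _ _ hN] at this
      simpa [mul_div_cancel₀] using this
    · have := ihr _ _ hr ((x - w) / 2) w y v (by linarith) hw hy hv
      rw [biEval_shiftOuter _ _ _ _ _ hM, biEval_shiftOuter _ _ _ _ _ hN] at this
      simpa [mul_div_cancel₀] using this
  | inner l r ihl ihr =>
    have h' : (hasShape n k M && hasShape n k N &&
      certify n k l (mapRec (fun row => shiftInner 2 row.reverse) M)
        (mapRec (fun row => shiftInner 2 row.reverse) N) &&
      certify n k r (mapRec (shiftInner 2) M) (mapRec (shiftInner 2) N)) = true := h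
    simp only [Bool.and_eq_true, hasShape_iff] at h'
    obtain ⟨⟨⟨⟨-, hM⟩, -, hN⟩, hl⟩, hr⟩ := h'
    rcases le_total y v with hyv | hyv
    · have := ihl _ _ hl x w ((v - y) / 2) y hx hw (by linarith) hy
      rw [biEval_map_shiftInner_reverse _ _ _ _ _ hM,
        biEval_map_shiftInner_reverse _ _ _ _ _ hN] at this
      simpa [mul_div_cancel₀] using this
    · have := ihr _ _ hr x w ((y - v) / 2) v hx hw (by linarith) hv
      rw [biEval_map_shiftInner _ _ _ _ _ hM, biEval_map_shiftInner _ _ _ _ _ hN] at this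
      simpa [mul_div_cancel₀] using this

/-- The polynomial `∑ c xⁱ yʲ` over the terms `(i, j, c)`, with `c` read through `e`. -/
def termEval (e : ℤ → ℝ) : List (ℕ × ℕ × ℤ) → ℝ → ℝ → ℝ
  | [], _, _ => 0
  | (i, j, c) :: T, x, y => e c * x ^ i * y ^ j + termEval e T x y

theorem biEval_toMatrix (n k : ℕ) (e : ℤ → ℕ) (T : List (ℕ × ℕ × ℤ)) (x y : ℝ) :
    biEval n k (toMatrix n k e T) x 1 y 1 = termEval (fun c => (e c : ℝ)) T x y := by
  induction T with
  | nil =>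
    exact formEval_replicate_zero (φ := fun row => formEval (Nat.cast : ℕ → ℝ) k row y 1) _
      (formEval_replicate_zero _ Nat.cast_zero _ _ _ _) _ _ _ _
  | cons t T ih =>
    obtain ⟨i, j, c⟩ := t
    have h := formEval_modifyCoeff (φ := fun row => formEval (Nat.cast : ℕ → ℝ) k row y 1)
      (z := []) (f := modifyCoeff 0 (· + e c) j) (δ := e c * y ^ j) rfl
      (fun a => formEval_modifyCoeff Nat.cast_zero (fun a => Nat.cast_add a (e c)) y a j k)
      x (toMatrix n k e T) i n
    rw [termEval, ← ih, toMatrix, biEval, h, biEval]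
    ring

theorem biEval_toBernstein {n k : ℕ} {e : ℤ → ℕ} {T : List (ℕ × ℕ × ℤ)}
    (h : hasShape n k (toMatrix n k e T) = true) (x y : ℝ) :
    biEval n k (toBernstein n k e T) (1 - x) x (1 - y) y =
      termEval (fun c => (e c : ℝ)) T x y := by
  obtain ⟨hM, hM'⟩ := hasShape_iff.1 h
  have hlen : (mapRec (fun row => shiftInner 1 row.reverse) (toMatrix n k e T)).length = n + 1 :=
    (length_mapRec _ _).trans hM
  rw [toBernstein, biEval_shiftOuter _ _ _ _ _ (by simpa using hlen), biEval_reverse _ _ _ _ hlen,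
    biEval_map_shiftInner_reverse _ _ _ _ _ hM', ← biEval_toMatrix n k]
  norm_num

theorem termEval_sub (T : List (ℕ × ℕ × ℤ)) (x y : ℝ) :
    termEval (fun c => (c.toNat : ℝ)) T x y - termEval (fun c => ((-c).toNat : ℝ)) T x y =
      termEval Int.cast T x y := by
  induction T with
  | nil => simp [termEval]
  | cons t T ih =>
    obtain ⟨i, j, c⟩ := t
    have hc : (c.toNat : ℝ) - ((-c).toNat : ℝ) = c := by
      exact_mod_cast Int.toNat_sub_toNat_neg c
    simp only [termEval]
    rw [← ih, ← hc]
    ring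

theorem termEval_nonpos_of_certifyTerms {n k : ℕ} {S : Subdivision} {T : List (ℕ × ℕ × ℤ)}
    (h : certifyTerms n k S T = true) {x y : ℝ} (hx : x ∈ Icc (0 : ℝ) 1)
    (hy : y ∈ Icc (0 : ℝ) 1) : termEval Int.cast T x y ≤ 0 := by
  simp only [certifyTerms, Bool.and_eq_true] at h
  obtain ⟨⟨hM, hN⟩, hS⟩ := h
  have := biEval_le_of_certify n k S _ _ hS (1 - x) x (1 - y) y (by linarith [hx.2]) hx.1
    (by linarith [hy.2]) hy.1
  rw [biEval_toBernstein hM, biEval_toBernstein hN] at this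
  linarith [termEval_sub T x y]

theorem certify_low_chartY_pos :
    ∃ S, certifyTerms 16 24 S
      (margin ++ chartY 1 (derivTerms 707 1000 lyapunovTerms)) = true :=
  ⟨(.outer (.inner .leaf .leaf) .leaf), by decide +kernel⟩

theorem certify_low_chartY_neg :
    ∃ S, certifyTerms 16 24 S
      (margin ++ chartY (-1) (derivTerms 707 1000 lyapunovTerms)) = true :=
  ⟨.leaf, by decide +kernel⟩

theorem certify_low_chartX_pos :
    ∃ S, certifyTerms 18 24 S
      (margin ++ chartX 1 (derivTerms 707 1000 lyapunovTerms)) = true :=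
  ⟨(.inner (.inner (.outer .leaf .leaf) (.outer (.inner (.outer (.outer .leaf .leaf)
      (.outer .leaf .leaf)) (.outer (.inner (.outer (.inner .leaf .leaf) .leaf) .leaf) (.inner
      (.outer (.inner .leaf .leaf) .leaf) (.outer .leaf (.inner .leaf .leaf))))) (.inner .leaf
      .leaf))) .leaf), by decide +kernel⟩

theorem certify_low_chartX_neg :
    ∃ S, certifyTerms 18 24 S
      (margin ++ chartX (-1) (derivTerms 707 1000 lyapunovTerms)) = true :=
  ⟨(.inner (.inner .leaf .leaf) .leaf), by decide +kernel⟩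

theorem certify_high_chartY_pos :
    ∃ S, certifyTerms 16 24 S
      (margin ++ chartY 1 (derivTerms 1849 2500 lyapunovTerms)) = true :=
  ⟨(.inner (.outer (.inner .leaf (.outer (.inner .leaf .leaf) (.inner .leaf .leaf)))
      (.inner .leaf .leaf)) .leaf), by decide +kernel⟩

theorem certify_high_chartY_neg :
    ∃ S, certifyTerms 16 24 S
      (margin ++ chartY (-1) (derivTerms 1849 2500 lyapunovTerms)) = true :=
  ⟨(.inner (.inner (.inner .leaf .leaf) .leaf) .leaf), by decide +kernel⟩

theorem certify_high_chartX_pos :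
    ∃ S, certifyTerms 18 24 S
      (margin ++ chartX 1 (derivTerms 1849 2500 lyapunovTerms)) = true :=
  ⟨(.inner (.inner (.outer .leaf .leaf) (.outer (.inner (.outer (.outer .leaf (.inner .leaf
      .leaf)) (.outer .leaf .leaf)) (.outer (.outer (.inner (.outer .leaf .leaf) .leaf) .leaf)
      (.inner .leaf .leaf))) (.inner (.inner .leaf .leaf) .leaf))) .leaf), by decide +kernel⟩

theorem certify_high_chartX_neg :
    ∃ S, certifyTerms 18 24 S
      (margin ++ chartX (-1) (derivTerms 1849 2500 lyapunovTerms)) = true :=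
  ⟨(.inner (.inner (.outer (.inner .leaf (.outer .leaf .leaf)) .leaf) .leaf) .leaf),
    by decide +kernel⟩

theorem termEval_append (e : ℤ → ℝ) (S T : List (ℕ × ℕ × ℤ)) (x y : ℝ) :
    termEval e (S ++ T) x y = termEval e S x y + termEval e T x y := by
  induction S with
  | nil => simp [termEval]
  | cons t S ih =>
    obtain ⟨i, j, c⟩ := t
    simp only [List.cons_append, termEval, ih]
    ring

theorem termEval_margin (x y : ℝ) : termEval Int.cast margin x y = 10000 * (1 - y) := by
  simp [margin, termEval]
  ring

theorem termEval_chartY (σ : ℤ) (T : List (ℕ × ℕ × ℤ)) (hT : ∀ t ∈ T, 8 ≤ 2 * t.1 + t.2.1)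
    (u y : ℝ) :
    y ^ 8 * termEval Int.cast (chartY σ T) u y = termEval Int.cast T (σ * u * y ^ 2) y := by
  induction T with
  | nil => simp [chartY, termEval]
  | cons t T ih =>
    obtain ⟨i, j, c⟩ := t
    obtain ⟨k, hk⟩ := Nat.exists_eq_add_of_le (hT (i, j, c) (by simp))
    have h := ih fun t ht => hT t (by simp [ht])
    have hpow : y ^ (2 * i) * y ^ j = y ^ 8 * y ^ k := by rw [← pow_add, ← pow_add, ← hk]
    simp only [chartY, List.map_cons, termEval] at h hk ⊢
    rw [← h, hk, Nat.add_sub_cancel_left, mul_pow, mul_pow, ← pow_mul]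
    push_cast
    linear_combination (-(c * σ ^ i * u ^ i : ℝ)) * hpow

theorem termEval_chartX (σ : ℤ) (T : List (ℕ × ℕ × ℤ)) (hT : ∀ t ∈ T, 8 ≤ 2 * t.1 + t.2.1)
    (v z : ℝ) :
    z ^ 8 * termEval Int.cast (chartX σ T) v z = termEval Int.cast T (z ^ 2) (σ * v * z) := by
  induction T with
  | nil => simp [chartX, termEval]
  | cons t T ih =>
    obtain ⟨i, j, c⟩ := t
    obtain ⟨k, hk⟩ := Nat.exists_eq_add_of_le (hT (i, j, c) (by simp))
    have h := ih fun t ht => hT t (by simp [ht])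
    have hpow : z ^ (2 * i) * z ^ j = z ^ 8 * z ^ k := by rw [← pow_add, ← pow_add, ← hk]
    simp only [chartX, List.map_cons, termEval] at h hk ⊢
    rw [← h, hk, Nat.add_sub_cancel_left, mul_pow, mul_pow, ← pow_mul]
    push_cast
    linear_combination (-(c * σ ^ j * v ^ j : ℝ)) * hpow

theorem termEval_neg_neg (T : List (ℕ × ℕ × ℤ)) (hT : ∀ t ∈ T, (t.1 + t.2.1) % 2 = 0 ∨ t.2.2 = 0)
    (x y : ℝ) : termEval Int.cast T (-x) (-y) = termEval Int.cast T x y := by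
  induction T with
  | nil => rfl
  | cons t T ih =>
    obtain ⟨i, j, c⟩ := t
    have h : (c : ℝ) * ((-1) ^ i * (-1) ^ j) = c := by
      rcases hT (i, j, c) (by simp) with h | h
      · rw [← pow_add, (Nat.even_iff.2 h).neg_one_pow, mul_one]
      · simp [show c = 0 from h]
    simp only [termEval]
    rw [ih fun t ht => hT t (by simp [ht]), neg_pow x, neg_pow y]
    linear_combination (x ^ i * y ^ j : ℝ) * h

/-- Negativity of a polynomial on the open square minus the origin, read off in the two
weighted blow-ups of the origin. -/
theorem termEval_neg_of_charts {T : List (ℕ × ℕ × ℤ)}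
    (hw : ∀ t ∈ T, 8 ≤ 2 * t.1 + t.2.1) (he : ∀ t ∈ T, (t.1 + t.2.1) % 2 = 0 ∨ t.2.2 = 0)
    (hY : ∀ σ ∈ ({1, -1} : Set ℤ), ∀ u ∈ Icc (0 : ℝ) 1, ∀ y ∈ Icc (0 : ℝ) 1,
      termEval Int.cast (margin ++ chartY σ T) u y ≤ 0)
    (hX : ∀ σ ∈ ({1, -1} : Set ℤ), ∀ v ∈ Icc (0 : ℝ) 1, ∀ z ∈ Icc (0 : ℝ) 1,
      termEval Int.cast (margin ++ chartX σ T) v z ≤ 0)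
    {x y : ℝ} (hx : |x| < 1) (hy : |y| < 1) (h0 : x ≠ 0 ∨ y ≠ 0) :
    termEval Int.cast T x y < 0 := by
  have sign : ∀ a : ℝ, ∃ σ ∈ ({1, -1} : Set ℤ), a = σ * |a| := fun a => by
    rcases abs_choice a with h | h
    · exact ⟨1, by simp, by simp [h]⟩
    · exact ⟨-1, by simp, by simp [h]⟩
  have key : ∀ r Q : ℝ, 0 < r → r < 1 → 10000 * (1 - r) + Q ≤ 0 → r ^ 8 * Q < 0 :=
    fun r Q h0 h1 h => mul_neg_of_pos_of_neg (pow_pos h0 8) (by linarith)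
  rcases le_or_gt |x| (y ^ 2) with hxy | hxy
  · have hy0 : y ≠ 0 := by
      rintro rfl
      have : x = 0 := by simpa using hxy
      simp [this] at h0
    have pos : ∀ x y : ℝ, 0 < y → y < 1 → |x| ≤ y ^ 2 → termEval Int.cast T x y < 0 := by
      intro x y h0 h1 h
      obtain ⟨σ, hσ, hs⟩ := sign x
      have hu : |x| / y ^ 2 ∈ Icc (0 : ℝ) 1 :=
        ⟨by positivity, (div_le_one (by positivity)).2 h⟩
      have := hY σ hσ _ hu y ⟨h0.le, h1.le⟩
      rw [termEval_append, termEval_margin] at this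
      have := key y _ h0 h1 this
      rwa [termEval_chartY σ T hw, mul_assoc, div_mul_cancel₀ _ (by positivity), ← hs] at this
    rcases lt_or_gt_of_ne hy0 with h | h
    · rw [← termEval_neg_neg T he]
      exact pos (-x) (-y) (by linarith) (by linarith [neg_abs_le y]) (by simpa using hxy)
    · exact pos x y h (lt_of_abs_lt hy) hxy
  · have hx0 : x ≠ 0 := by
      rintro rfl
      exact absurd hxy (by simpa using sq_nonneg y)
    have pos : ∀ x y : ℝ, 0 < x → x < 1 → y ^ 2 < x → termEval Int.cast T x y < 0 := by
      intro x y h0 h1 h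
      obtain ⟨σ, hσ, hs⟩ := sign y
      have hz : 0 < √x := Real.sqrt_pos.2 h0
      have hz1 : √x < 1 := (Real.sqrt_lt' one_pos).2 (by simpa using h1)
      have hv : |y| / √x ∈ Icc (0 : ℝ) 1 :=
        ⟨by positivity, (div_le_one hz).2 (Real.abs_le_sqrt h.le)⟩
      have := hX σ hσ _ hv (√x) ⟨hz.le, hz1.le⟩
      rw [termEval_append, termEval_margin] at this
      have := key (√x) _ hz hz1 this
      rwa [termEval_chartX σ T hw, mul_assoc, div_mul_cancel₀ _ hz.ne', ← hs,
        Real.sq_sqrt h0.le] at this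
    rcases lt_or_gt_of_ne hx0 with h | h
    · rw [← termEval_neg_neg T he]
      exact pos (-x) (-y) (by linarith) (by linarith [neg_abs_le x])
        (by simpa [abs_of_neg h] using hxy)
    · exact pos x y h (lt_of_abs_lt hx) (by simpa [abs_of_pos h] using hxy)

/-- The derivative, along `(y³ - x³) ∂ₓ + μ (y⁵ - x) ∂ᵧ`, of
`10000 (μ x² / 2 + y⁴ / 4)` plus the polynomial with the given terms. -/
def fieldDeriv (μ : ℝ) : List (ℕ × ℕ × ℤ) → ℝ → ℝ → ℝ
  | [], x, y => 10000 * μ * (y ^ 8 - x ^ 4)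
  | (i, j, c) :: T, x, y => c * (i * x ^ (i - 1) * y ^ j * (y ^ 3 - x ^ 3) +
      μ * (x ^ i * (j * y ^ (j - 1)) * (y ^ 5 - x))) + fieldDeriv μ T x y

theorem termEval_derivTerms (p q : ℤ) (hq : (q : ℝ) ≠ 0) (T : List (ℕ × ℕ × ℤ)) (x y : ℝ) :
    termEval Int.cast (derivTerms p q T) x y = q * fieldDeriv (p / q) T x y := by
  induction T with
  | nil =>
    simp only [derivTerms, termEval, fieldDeriv]
    push_cast
    field_simp
    ring
  | cons t T ih =>
    obtain ⟨i, j, c⟩ := t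
    simp only [derivTerms, termEval, fieldDeriv, ih]
    push_cast
    obtain ⟨r, hr⟩ : ∃ r : ℝ, (p : ℝ) = q * r := ⟨p / q, (mul_div_cancel₀ _ hq).symm⟩
    rw [hr, mul_div_cancel_left₀ _ hq]
    rcases i with _ | i <;> rcases j with _ | j <;> push_cast <;> simp <;> ring

theorem fieldDeriv_convex (a b μ ν : ℝ) (hab : a + b = 1) (T : List (ℕ × ℕ × ℤ)) (x y : ℝ) :
    fieldDeriv (a * μ + b * ν) T x y = a * fieldDeriv μ T x y + b * fieldDeriv ν T x y := by
  induction T with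
  | nil =>
    simp only [fieldDeriv]
    ring
  | cons t T ih =>
    obtain ⟨i, j, c⟩ := t
    simp only [fieldDeriv, ih]
    linear_combination (-(c * (i * x ^ (i - 1) * y ^ j * (y ^ 3 - x ^ 3))) : ℝ) * hab

theorem fieldDeriv_neg {μ : ℝ} (hμ₁ : 707 / 1000 ≤ μ) (hμ₂ : μ ≤ 1849 / 2500) {x y : ℝ}
    (hx : |x| < 1) (hy : |y| < 1) (h0 : x ≠ 0 ∨ y ≠ 0) :
    fieldDeriv μ lyapunovTerms x y < 0 := by
  have hlow : fieldDeriv (707 / 1000) lyapunovTerms x y < 0 := by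
    have := termEval_neg_of_charts (T := derivTerms 707 1000 lyapunovTerms)
      (by decide +kernel) (by decide +kernel)
      (by
        rintro σ (rfl | rfl) u hu y hy
        · exact termEval_nonpos_of_certifyTerms certify_low_chartY_pos.choose_spec hu hy
        · exact termEval_nonpos_of_certifyTerms certify_low_chartY_neg.choose_spec hu hy)
      (by
        rintro σ (rfl | rfl) u hu y hy
        · exact termEval_nonpos_of_certifyTerms certify_low_chartX_pos.choose_spec hu hy
        · exact termEval_nonpos_of_certifyTerms certify_low_chartX_neg.choose_spec hu hy)
      hx hy h0
    rw [termEval_derivTerms _ _ (by norm_num)] at this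
    norm_num at this
    linarith
  have hhigh : fieldDeriv (1849 / 2500) lyapunovTerms x y < 0 := by
    have := termEval_neg_of_charts (T := derivTerms 1849 2500 lyapunovTerms)
      (by decide +kernel) (by decide +kernel)
      (by
        rintro σ (rfl | rfl) u hu y hy
        · exact termEval_nonpos_of_certifyTerms certify_high_chartY_pos.choose_spec hu hy
        · exact termEval_nonpos_of_certifyTerms certify_high_chartY_neg.choose_spec hu hy)
      (by
        rintro σ (rfl | rfl) u hu y hy
        · exact termEval_nonpos_of_certifyTerms certify_high_chartX_pos.choose_spec hu hy
        · exact termEval_nonpos_of_certifyTerms certify_high_chartX_neg.choose_spec hu hy)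
      hx hy h0
    rw [termEval_derivTerms _ _ (by norm_num)] at this
    norm_num at this
    linarith
  obtain ⟨a, b, ha, hb, hab, rfl⟩ : μ ∈ segment ℝ (707 / 1000 : ℝ) (1849 / 2500) := by
    rw [segment_eq_Icc (by norm_num)]
    exact ⟨hμ₁, hμ₂⟩
  rw [smul_eq_mul, smul_eq_mul, fieldDeriv_convex a b _ _ hab]
  rcases ha.eq_or_lt with rfl | ha
  · obtain rfl : b = 1 := by linarith
    linarith
  · nlinarith [mul_neg_of_pos_of_neg ha hlow, mul_nonneg hb (neg_nonneg.2 hhigh.le)]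

/-- The Lyapunov function on the square spanned by the saddles. -/
def lyapunov (μ : ℝ) (x y : ℝ) : ℝ :=
  10000 * (μ * x ^ 2 / 2 + y ^ 4 / 4) + termEval Int.cast lyapunovTerms x y

theorem lyapunov_neg_neg (μ x y : ℝ) : lyapunov μ (-x) (-y) = lyapunov μ x y := by
  rw [lyapunov, lyapunov, termEval_neg_neg _ (by decide +kernel), Even.neg_pow (by decide),
    Even.neg_pow (by decide)]

theorem continuous_termEval (e : ℤ → ℝ) (T : List (ℕ × ℕ × ℤ)) :
    Continuous fun p : ℝ × ℝ => termEval e T p.1 p.2 := by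
  induction T with
  | nil => exact continuous_const
  | cons t T ih =>
    simp only [termEval]
    fun_prop

theorem continuous_lyapunov (μ : ℝ) : Continuous fun p : ℝ × ℝ => lyapunov μ p.1 p.2 := by
  have := continuous_termEval Int.cast lyapunovTerms
  unfold lyapunov
  fun_prop

/-- The rescaled system `μ x' = y³ - x³`, `y' = y⁵ - x`, whose saddles are `±(1, 1)`. -/
structure IsRescaledSolution (μ : ℝ) (x y : ℝ → ℝ) : Prop where
  hasDerivAt_fst : ∀ t, HasDerivAt x ((y t ^ 3 - x t ^ 3) / μ) t
  hasDerivAt_snd : ∀ t, HasDerivAt y (y t ^ 5 - x t) t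

theorem IsRescaledSolution.hasDerivAt_lyapunov {μ : ℝ} {x y : ℝ → ℝ} (hμ : μ ≠ 0)
    (h : IsRescaledSolution μ x y) (t : ℝ) :
    HasDerivAt (fun t => lyapunov μ (x t) (y t))
      (fieldDeriv μ lyapunovTerms (x t) (y t) / μ) t := by
  have hx := h.hasDerivAt_fst t
  have hy := h.hasDerivAt_snd t
  suffices H : ∀ T, HasDerivAt (fun t => 10000 * (μ * x t ^ 2 / 2 + y t ^ 4 / 4) +
      termEval Int.cast T (x t) (y t)) (fieldDeriv μ T (x t) (y t) / μ) t from H _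
  intro T
  induction T with
  | nil =>
    simp only [termEval, fieldDeriv, add_zero]
    convert! ((((hx.pow 2).const_mul μ).div_const 2).add ((hy.pow 4).div_const 4)).const_mul
      10000 using 1
    field_simp
    ring
  | cons s T ih =>
    obtain ⟨i, j, c⟩ := s
    simp only [termEval, fieldDeriv]
    convert! (((hx.pow i).const_mul (c : ℝ)).mul (hy.pow j)).add ih using 1
    · ext r
      simp only [Pi.add_apply, Pi.mul_apply, Pi.pow_apply]
      ring
    · simp only [Pi.pow_apply]
      field_simp

theorem HasDerivAt.eventually_gt_of_pos {f : ℝ → ℝ} {f' t : ℝ} (h : HasDerivAt f f' t)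
    (hf' : 0 < f') : ∀ᶠ s in nhdsWithin t (Ioi t), f t < f s := by
  have := (hasDerivAt_iff_tendsto_slope.1 h).mono_left
    (nhdsWithin_mono t fun s (hs : t < s) => hs.ne')
  filter_upwards [this.eventually (lt_mem_nhds hf'), self_mem_nhdsWithin] with s hs hts
  rw [slope_def_field, div_pos_iff_of_pos_right (sub_pos.2 hts)] at hs
  linarith

section Cone

variable {P T a b c d : ℝ → ℝ} {t₀ : ℝ}

theorem exists_pos_of_cone
    (hP : ∀ t, HasDerivAt P (a t * T t + b t * P t) t)
    (hT : ∀ t, HasDerivAt T (c t * P t + d t * T t) t)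
    (hcone : ∀ t, 0 ≤ P t → 0 ≤ T t → 0 < a t ∧ 0 ≤ b t ∧ 0 < c t)
    (hP₀ : 0 ≤ P t₀) (hT₀ : 0 ≤ T t₀) (hne : P t₀ ≠ 0 ∨ T t₀ ≠ 0) :
    ∃ t, 0 < P t ∧ 0 < T t := by
  obtain ⟨ha, -, hc⟩ := hcone t₀ hP₀ hT₀
  rcases hP₀.eq_or_lt with hP0 | hPpos
  · have hTpos : 0 < T t₀ := hT₀.lt_of_ne' (hne.resolve_left (by simp [← hP0]))
    have h₁ := (hP t₀).eventually_gt_of_pos (by rw [← hP0]; nlinarith)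
    have h₂ := (hT t₀).continuousAt.eventually (lt_mem_nhds hTpos)
    obtain ⟨t, ht⟩ := (h₁.and (h₂.filter_mono nhdsWithin_le_nhds)).exists
    exact ⟨t, hP0 ▸ ht.1, ht.2⟩
  · rcases hT₀.eq_or_lt with hT0 | hTpos
    · have h₁ := (hT t₀).eventually_gt_of_pos (by rw [← hT0]; nlinarith)
      have h₂ := (hP t₀).continuousAt.eventually (lt_mem_nhds hPpos)
      obtain ⟨t, ht⟩ := (h₁.and (h₂.filter_mono nhdsWithin_le_nhds)).exists
      exact ⟨t, ht.2, hT0 ▸ ht.1⟩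
    · exact ⟨t₀, hPpos, hTpos⟩

theorem pos_of_cone
    (hP : ∀ t, HasDerivAt P (a t * T t + b t * P t) t)
    (hT : ∀ t, HasDerivAt T (c t * P t + d t * T t) t) (hd : Continuous d)
    (hcone : ∀ t, 0 ≤ P t → 0 ≤ T t → 0 < a t ∧ 0 ≤ b t ∧ 0 < c t)
    (hP₀ : 0 < P t₀) (hT₀ : 0 < T t₀) {t : ℝ} (ht : t₀ ≤ t) :
    0 < P t ∧ 0 < T t := by
  have cP : Continuous P := continuous_iff_continuousAt.2 fun t => (hP t).continuousAt
  have cT : Continuous T := continuous_iff_continuousAt.2 fun t => (hT t).continuousAt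
  by_contra hcon
  set S := {s | t₀ ≤ s ∧ min (P s) (T s) ≤ 0}
  have hSc : IsClosed S :=
    (isClosed_le continuous_const continuous_id).inter (isClosed_le (cP.min cT) continuous_const)
  have hSne : S.Nonempty := ⟨t, ht, by
    rw [← lt_min_iff] at hcon
    exact not_lt.1 hcon⟩
  have hSb : BddBelow S := ⟨t₀, fun s hs => hs.1⟩
  obtain ⟨hs₀, hs⟩ := hSc.csInf_mem hSne hSb
  set s := sInf S
  have hpos : ∀ r ∈ Ioo t₀ s, 0 < P r ∧ 0 < T r := fun r hr => by
    rw [← lt_min_iff]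
    exact not_le.1 fun h => notMem_of_lt_csInf hr.2 hSb ⟨hr.1.le, h⟩
  have hPmono : MonotoneOn P (Icc t₀ s) := by
    refine monotoneOn_of_hasDerivWithinAt_nonneg (convex_Icc _ _) cP.continuousOn
      (fun r _ => (hP r).hasDerivWithinAt) fun r hr => ?_
    rw [interior_Icc] at hr
    obtain ⟨h₁, h₂⟩ := hpos r hr
    obtain ⟨ha, hb, -⟩ := hcone r h₁.le h₂.le
    positivity
  obtain ⟨K, hK⟩ := (isCompact_Icc (a := t₀) (b := s)).exists_bound_of_continuousOn hd.continuousOn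
  have hTmono : MonotoneOn (fun r => T r * exp (K * r)) (Icc t₀ s) := by
    refine monotoneOn_of_hasDerivWithinAt_nonneg (convex_Icc _ _) (by fun_prop)
      (fun r _ => ((hT r).mul ((hasDerivAt_id r).const_mul K).exp).hasDerivWithinAt)
      fun r hr => ?_
    rw [interior_Icc] at hr
    obtain ⟨h₁, h₂⟩ := hpos r hr
    obtain ⟨-, -, hc⟩ := hcone r h₁.le h₂.le
    have hKr := neg_le_of_abs_le (hK r (Ioo_subset_Icc_self hr))
    have : 0 ≤ (c r * P r + (d r + K) * T r) * exp (K * r) := by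
      have : 0 ≤ d r + K := by linarith
      positivity
    simp only [id]
    linarith
  have h₁ := hPmono (left_mem_Icc.2 hs₀) (right_mem_Icc.2 hs₀) hs₀
  have h₂ := hTmono (left_mem_Icc.2 hs₀) (right_mem_Icc.2 hs₀) hs₀
  have h₃ : 0 < T s * exp (K * s) := lt_of_lt_of_le (by positivity) h₂
  exact absurd hs (not_le.2 (lt_min (hP₀.trans_le h₁) (pos_of_mul_pos_left h₃ (exp_pos _).le)))

/-- A solution of the linear-like system `P' = a T + b P`, `T' = c P + d T` that meets the
closed positive quadrant away from its vertex has `P` positive and increasing eventually. -/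
theorem exists_strictMonoOn_of_cone
    (hP : ∀ t, HasDerivAt P (a t * T t + b t * P t) t)
    (hT : ∀ t, HasDerivAt T (c t * P t + d t * T t) t) (hd : Continuous d)
    (hcone : ∀ t, 0 ≤ P t → 0 ≤ T t → 0 < a t ∧ 0 ≤ b t ∧ 0 < c t)
    (hP₀ : 0 ≤ P t₀) (hT₀ : 0 ≤ T t₀)
    (hne : P t₀ ≠ 0 ∨ T t₀ ≠ 0) : ∃ t, 0 < P t ∧ StrictMonoOn P (Ici t) := by
  obtain ⟨t, hPt, hTt⟩ := exists_pos_of_cone hP hT hcone hP₀ hT₀ hne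
  refine ⟨t, hPt, strictMonoOn_of_hasDerivWithinAt_pos (convex_Ici t)
    (fun r _ => (hP r).continuousAt.continuousWithinAt) (fun r _ => (hP r).hasDerivWithinAt)
    fun r hr => ?_⟩
  rw [interior_Ici] at hr
  obtain ⟨h₁, h₂⟩ := pos_of_cone hP hT hd hcone hPt hTt (le_of_lt hr)
  obtain ⟨ha, hb, -⟩ := hcone r h₁.le h₂.le
  positivity

end Cone

theorem fieldDeriv_lyapunovTerms_zero (μ : ℝ) : fieldDeriv μ lyapunovTerms 0 0 = 0 := by
  simp [lyapunovTerms, fieldDeriv]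

theorem fieldDeriv_diag_of_sq_eq_one {μ σ : ℝ} (hσ : σ ^ 2 = 1) (T : List (ℕ × ℕ × ℤ)) :
    fieldDeriv μ T σ σ = 0 := by
  have h₄ : σ ^ 4 = 1 := by linear_combination (σ ^ 2 + 1) * hσ
  induction T with
  | nil => simp only [fieldDeriv]; linear_combination (10000 * μ * σ ^ 4) * h₄
  | cons t T ih =>
    obtain ⟨i, j, c⟩ := t
    simp only [fieldDeriv, ih]
    linear_combination (c * μ * σ ^ i * (j * σ ^ (j - 1)) * σ) * h₄

/-- `f` never rises above the level `1` to increase forever. -/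
def NoEscape (f : ℝ → ℝ) : Prop := ∀ t, 1 < f t → ¬ StrictMonoOn f (Ici t)

theorem Function.Periodic.noEscape {f : ℝ → ℝ} {T : ℝ} (hf : Function.Periodic f T)
    (hT : 0 < T) : NoEscape f := fun t _ hmono =>
  (hmono self_mem_Ici (show t ≤ t + T by linarith) (by linarith)).ne (hf t).symm

theorem Filter.Tendsto.noEscape {f : ℝ → ℝ} {l : ℝ} (hf : Tendsto f atTop (nhds l))
    (hl : l ≤ 1) : NoEscape f := fun t ht hmono =>
  absurd (ge_of_tendsto hf ((eventually_ge_atTop t).mono fun _ hs =>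
    hmono.monotoneOn self_mem_Ici hs hs)) (by linarith)

namespace IsRescaledSolution

variable {μ : ℝ} {x y : ℝ → ℝ}

theorem neg (h : IsRescaledSolution μ x y) : IsRescaledSolution μ (-x) (-y) where
  hasDerivAt_fst t := by
    convert! (h.hasDerivAt_fst t).neg using 1
    simp only [Pi.neg_apply]
    ring
  hasDerivAt_snd t := by
    convert! (h.hasDerivAt_snd t).neg using 1
    simp only [Pi.neg_apply]
    ring

theorem continuous_fst (h : IsRescaledSolution μ x y) : Continuous x :=
  continuous_iff_continuousAt.2 fun t => (h.hasDerivAt_fst t).continuousAt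

theorem continuous_snd (h : IsRescaledSolution μ x y) : Continuous y :=
  continuous_iff_continuousAt.2 fun t => (h.hasDerivAt_snd t).continuousAt

theorem eq_one_of_one_le_snd (h : IsRescaledSolution μ x y)
    (hy : NoEscape y) {t : ℝ} (h₁ : 1 ≤ y t) (h₂ : x t ≤ y t) :
    x t = 1 ∧ y t = 1 := by
  have cx := h.continuous_fst
  have cy := h.continuous_snd
  by_contra hne
  obtain ⟨s, hs, hmono⟩ := exists_strictMonoOn_of_cone
    (P := fun t => y t - 1) (T := fun t => y t - x t) (a := fun _ => 1)
    (b := fun t => y t * (y t + 1) * (y t ^ 2 + 1))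
    (c := fun t => y t * (y t + 1) * (y t ^ 2 + 1))
    (d := fun t => 1 - (x t ^ 2 + x t * y t + y t ^ 2) / μ)
    (fun t => by convert! (h.hasDerivAt_snd t).sub_const 1 using 1; ring)
    (fun t => by convert! (h.hasDerivAt_snd t).sub (h.hasDerivAt_fst t) using 1; ring)
    (by fun_prop)
    (fun t hP _ => by
      have : 0 < y t := by linarith
      exact ⟨one_pos, by positivity, by positivity⟩)
    (sub_nonneg.2 h₁) (sub_nonneg.2 h₂)
    (by
      rw [← not_and_or]
      rintro ⟨h₃, h₄⟩
      exact hne ⟨by linarith, by linarith⟩)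
  exact hy s (by linarith) fun p hp q hq hpq => by linarith [hmono hp hq hpq]

theorem eq_one_of_one_le_fst (h : IsRescaledSolution μ x y)
    (hμ : 0 < μ) (hx : NoEscape fun t => x (-t)) {t : ℝ}
    (h₁ : 1 ≤ x t) (h₂ : y t ≤ x t) : x t = 1 ∧ y t = 1 := by
  have cx := h.continuous_fst
  have cy := h.continuous_snd
  have hx' : ∀ t, HasDerivAt (fun t => x (-t)) (-((y (-t) ^ 3 - x (-t) ^ 3) / μ)) t := fun t => by
    simpa [Function.comp_def] using (h.hasDerivAt_fst (-t)).comp t (hasDerivAt_neg t)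
  have hy' : ∀ t, HasDerivAt (fun t => y (-t)) (-(y (-t) ^ 5 - x (-t))) t := fun t => by
    simpa [Function.comp_def] using (h.hasDerivAt_snd (-t)).comp t (hasDerivAt_neg t)
  by_contra hne
  obtain ⟨s, hs, hmono⟩ := exists_strictMonoOn_of_cone (t₀ := -t)
    (P := fun t => x (-t) - 1) (T := fun t => x (-t) - y (-t))
    (a := fun t => (x (-t) ^ 2 + x (-t) * y (-t) + y (-t) ^ 2) / μ) (b := fun _ => 0)
    (c := fun t => x (-t) * (x (-t) + 1) * (x (-t) ^ 2 + 1))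
    (d := fun t => (x (-t) ^ 2 + x (-t) * y (-t) + y (-t) ^ 2) / μ -
      (x (-t) ^ 4 + x (-t) ^ 3 * y (-t) + x (-t) ^ 2 * y (-t) ^ 2 + x (-t) * y (-t) ^ 3 +
        y (-t) ^ 4))
    (fun t => by convert! (hx' t).sub_const 1 using 1; ring)
    (fun t => by convert! (hx' t).sub (hy' t) using 1; ring)
    (by fun_prop)
    (fun t hP _ => by
      have : 0 < x (-t) := by linarith
      refine ⟨div_pos ?_ hμ, le_rfl, by positivity⟩
      nlinarith [sq_nonneg (x (-t) + 2 * y (-t))])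
    (by simpa using h₁) (by simpa using h₂)
    (by
      rw [← not_and_or, neg_neg]
      rintro ⟨h₃, h₄⟩
      exact hne ⟨by linarith, by linarith⟩)
  exact hx s (by linarith) fun p hp q hq hpq => by linarith [hmono hp hq hpq]

theorem lt_one_or_eq_one (h : IsRescaledSolution μ x y)
    (hμ : 0 < μ) (hx : NoEscape fun t => x (-t)) (hy : NoEscape y) (t : ℝ) :
    (x t < 1 ∧ y t < 1) ∨ (x t = 1 ∧ y t = 1) := by
  by_contra! hcon
  obtain ⟨h₁, h₂⟩ := hcon
  refine (show ¬(x t = 1 ∧ y t = 1) from fun h => h₂ h.1 h.2) ?_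
  rcases le_total (x t) (y t) with hxy | hxy
  · refine h.eq_one_of_one_le_snd hy ?_ hxy
    by_contra! hlt
    linarith [h₁ (by linarith)]
  · refine h.eq_one_of_one_le_fst hμ hx ?_ hxy
    by_contra! hlt
    linarith [h₁ hlt]

/-- A solution that does not escape stays in the open square spanned by the two saddles,
unless it meets one of them. -/
theorem confined (h : IsRescaledSolution μ x y)
    (hμ : 0 < μ) (hx : NoEscape fun t => x (-t)) (hy : NoEscape y)
    (hx' : NoEscape fun t => -x (-t)) (hy' : NoEscape fun t => -y t) (t : ℝ) :
    (|x t| < 1 ∧ |y t| < 1) ∨ (x t = 1 ∧ y t = 1) ∨ (x t = -1 ∧ y t = -1) := by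
  have h₁ := h.lt_one_or_eq_one hμ hx hy t
  have h₂ := h.neg.lt_one_or_eq_one hμ hx' hy' t
  simp only [Pi.neg_apply, neg_eq_iff_eq_neg] at h₂
  rcases h₁ with ⟨hx₁, hy₁⟩ | h₁
  · rcases h₂ with ⟨hx₂, hy₂⟩ | h₂
    · exact Or.inl ⟨abs_lt.2 ⟨by linarith, hx₁⟩, abs_lt.2 ⟨by linarith, hy₁⟩⟩
    · exact Or.inr (Or.inr h₂)
  · exact Or.inr (Or.inl h₁)

theorem antitone_lyapunov (h : IsRescaledSolution μ x y) (hμ₁ : 707 / 1000 ≤ μ)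
    (hμ₂ : μ ≤ 1849 / 2500)
    (hc : ∀ t, (|x t| < 1 ∧ |y t| < 1) ∨ (x t = 1 ∧ y t = 1) ∨ (x t = -1 ∧ y t = -1)) :
    Antitone fun t => lyapunov μ (x t) (y t) := by
  have hμ : 0 < μ := by linarith
  refine antitone_of_hasDerivAt_nonpos (h.hasDerivAt_lyapunov hμ.ne') fun t => ?_
  refine div_nonpos_of_nonpos_of_nonneg ?_ hμ.le
  rcases hc t with ⟨hx, hy⟩ | ⟨hx, hy⟩ | ⟨hx, hy⟩
  · by_cases h0 : x t ≠ 0 ∨ y t ≠ 0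
    · exact (fieldDeriv_neg hμ₁ hμ₂ hx hy h0).le
    · push Not at h0
      rw [h0.1, h0.2, fieldDeriv_lyapunovTerms_zero]
  · rw [hx, hy, fieldDeriv_diag_of_sq_eq_one (by norm_num)]
  · rw [hx, hy, fieldDeriv_diag_of_sq_eq_one (by norm_num)]

theorem eq_of_lyapunov_eq (h : IsRescaledSolution μ x y) (hμ₁ : 707 / 1000 ≤ μ)
    (hμ₂ : μ ≤ 1849 / 2500)
    (hc : ∀ t, (|x t| < 1 ∧ |y t| < 1) ∨ (x t = 1 ∧ y t = 1) ∨ (x t = -1 ∧ y t = -1))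
    {l : ℝ} (hl : ∀ t, lyapunov μ (x t) (y t) = l) (s t : ℝ) :
    x s = x t ∧ y s = y t := by
  have hμ : 0 < μ := by linarith
  have hz : ∀ t, y t = x t ∧ y t ^ 5 = x t := fun t => by
    rcases hc t with ⟨hx, hy⟩ | ⟨hx, hy⟩ | ⟨hx, hy⟩
    · by_cases h0 : x t ≠ 0 ∨ y t ≠ 0
      · have h₁ := h.hasDerivAt_lyapunov hμ.ne' t
        simp only [hl] at h₁
        have h₂ := (div_eq_zero_iff.1 (h₁.unique (hasDerivAt_const t l))).resolve_right hμ.ne'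
        exact absurd h₂ (fieldDeriv_neg hμ₁ hμ₂ hx hy h0).ne
      · push Not at h0
        simp [h0]
    · norm_num [hx, hy]
    · norm_num [hx, hy]
  constructor
  · refine is_const_of_deriv_eq_zero (fun t => (h.hasDerivAt_fst t).differentiableAt)
      (fun t => ?_) s t
    rw [(h.hasDerivAt_fst t).deriv, (hz t).1, sub_self, zero_div]
  · refine is_const_of_deriv_eq_zero (fun t => (h.hasDerivAt_snd t).differentiableAt)
      (fun t => ?_) s t
    rw [(h.hasDerivAt_snd t).deriv, (hz t).2, sub_self]

end IsRescaledSolution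

theorem Antitone.eq_of_periodic {w : ℝ → ℝ} {T : ℝ} (hw : Antitone w)
    (hp : Function.Periodic w T) (hT : 0 < T) (s t : ℝ) : w s = w t := by
  have key : ∀ s t, w s ≤ w t := fun s t => by
    obtain ⟨n, hn⟩ := Archimedean.arch (t - s) hT
    rw [← hp.nsmul n s]
    exact hw (by linarith)
  exact le_antisymm (key s t) (key t s)

section Rescaling

variable {m : ℝ}

theorem pow_four_rpow (hm : 0 < m) : (m ^ (1 / 4 : ℝ)) ^ 4 = m := by
  rw [← rpow_natCast, ← rpow_mul hm.le]
  norm_num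

theorem rpow_mul_rpow_neg (hm : 0 < m) : m ^ (1 / 4 : ℝ) * m ^ (-(1 : ℝ) / 4) = 1 := by
  rw [← rpow_add hm]
  norm_num

theorem IsSolution.isRescaledSolution {γ : ℝ → ℝ × ℝ} (hm : 0 < m) (h : IsSolution m γ) :
    IsRescaledSolution ((m ^ (1 / 4 : ℝ)) ^ 2) (fun t => m ^ (1 / 4 : ℝ) * (γ t).1)
      (fun t => m ^ (1 / 4 : ℝ) * (γ t).2) := by
  have h₄ := pow_four_rpow hm
  have hr : 0 < m ^ (1 / 4 : ℝ) := rpow_pos_of_pos hm _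
  set r := m ^ (1 / 4 : ℝ)
  constructor <;> intro t
  · convert! (hasFDerivAt_fst.comp_hasDerivAt t (h t)).const_mul r using 1
    simp only [bacciotti, ContinuousLinearMap.coe_fst']
    field_simp
  · convert! (hasFDerivAt_snd.comp_hasDerivAt t (h t)).const_mul r using 1
    simp only [bacciotti, ContinuousLinearMap.coe_snd']
    linear_combination (r * (γ t).2 ^ 5) * h₄

theorem rpow_sq_mem_Icc (hm₁ : 0.5 ≤ m) (hm₂ : m ≤ 0.547) :
    (m ^ (1 / 4 : ℝ)) ^ 2 ∈ Icc (707 / 1000 : ℝ) (1849 / 2500) := by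
  have h₄ := pow_four_rpow (m := m) (by linarith)
  have hr : 0 ≤ (m ^ (1 / 4 : ℝ)) ^ 2 := by positivity
  constructor <;> nlinarith

end Rescaling

theorem bacciotti_no_cycles_half_to_547 (m : ℝ) (hm₁ : 0.5 ≤ m) (hm₂ : m ≤ 0.547) :
    (¬ ∃ (γ : ℝ → ℝ × ℝ) (T : ℝ), IsPeriodicOrbit m γ T) ∧
    (¬ ∃ γ : ℝ → ℝ × ℝ, IsHeteroclinic m γ) := by
  have hm : 0 < m := by linarith
  obtain ⟨hμ₁, hμ₂⟩ := rpow_sq_mem_Icc hm₁ hm₂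
  have hr : 0 < m ^ (1 / 4 : ℝ) := rpow_pos_of_pos hm _
  have hμ : 0 < (m ^ (1 / 4 : ℝ)) ^ 2 := by positivity
  constructor
  · rintro ⟨γ, T, hγ, hne, hT, hper⟩
    have h := hγ.isRescaledSolution hm
    have hx : Function.Periodic (fun t => m ^ (1 / 4 : ℝ) * (γ t).1) T :=
      fun t => by simp only [hper t]
    have hy : Function.Periodic (fun t => m ^ (1 / 4 : ℝ) * (γ t).2) T :=
      fun t => by simp only [hper t]
    have hx' : Function.Periodic (fun t => m ^ (1 / 4 : ℝ) * (γ (-t)).1) T := fun t => by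
      simp only [neg_add, ← sub_eq_add_neg, hper.sub_eq]
    have hc := h.confined hμ (hx'.noEscape hT) (hy.noEscape hT)
      (Function.Periodic.noEscape (fun t => congrArg Neg.neg (hx' t)) hT)
      (Function.Periodic.noEscape (fun t => congrArg Neg.neg (hy t)) hT)
    have hw := (h.antitone_lyapunov hμ₁ hμ₂ hc).eq_of_periodic
      (fun t => by simp only [hper t]) hT
    refine hne ⟨γ 0, fun t => ?_⟩
    obtain ⟨h₁, h₂⟩ := h.eq_of_lyapunov_eq hμ₁ hμ₂ hc (fun t => hw t 0) t 0
    exact Prod.ext (mul_left_cancel₀ hr.ne' h₁) (mul_left_cancel₀ hr.ne' h₂)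
  · rintro ⟨γ, hγ, hbot, htop⟩
    have h := hγ.isRescaledSolution hm
    have h1 := rpow_mul_rpow_neg hm
    generalize m ^ (1 / 4 : ℝ) = r at *
    have hxbot : Tendsto (fun t => r * (γ t).1) atBot (nhds (-1)) := by
      simpa [pMinus, h1] using ((continuous_fst.tendsto _).comp hbot).const_mul r
    have hybot : Tendsto (fun t => r * (γ t).2) atBot (nhds (-1)) := by
      simpa [pMinus, h1] using ((continuous_snd.tendsto _).comp hbot).const_mul r
    have hxtop : Tendsto (fun t => r * (γ t).1) atTop (nhds 1) := by
      simpa [pPlus, h1] using ((continuous_fst.tendsto _).comp htop).const_mul r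
    have hytop : Tendsto (fun t => r * (γ t).2) atTop (nhds 1) := by
      simpa [pPlus, h1] using ((continuous_snd.tendsto _).comp htop).const_mul r
    have hx' := hxbot.comp tendsto_neg_atTop_atBot
    have hc := h.confined hμ (hx'.noEscape (by norm_num)) (hytop.noEscape le_rfl)
      (hx'.neg.noEscape (by norm_num)) (hytop.neg.noEscape (by norm_num))
    have hanti := h.antitone_lyapunov hμ₁ hμ₂ hc
    have hcont := continuous_lyapunov (r ^ 2)
    have hwtop := (hcont.tendsto (1, 1)).comp (hxtop.prodMk_nhds hytop)
    have hwbot := (hcont.tendsto (-1, -1)).comp (hxbot.prodMk_nhds hybot)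
    rw [lyapunov_neg_neg] at hwbot
    have hw := fun t => le_antisymm (hanti.ge_of_tendsto hwbot t) (hanti.le_of_tendsto hwtop t)
    have hconst := fun t => (h.eq_of_lyapunov_eq hμ₁ hμ₂ hc hw t 0).1
    simp only [hconst] at hxbot hxtop
    linarith [tendsto_nhds_unique hxbot tendsto_const_nhds,
      tendsto_nhds_unique hxtop tendsto_const_nhds]

end
end
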